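/- arXiv:2603.18770 — 6 statements merged into one kernel-verified Lean document; each statement's English description precedes it below -/
import Mathlib

section
/- Let f ∈ C²((0,∞)) with f'' > 0 on (0,∞) be such that ∫_s^∞ dy/(y³ f''(y)) < ∞ and ∫_0^s dy/(y² f''(y)) < ∞ for every s > 0. Then for every η ≥ 0 the function ξ_η is continuously differentiable on (0,∞) and satisfies the ordinary differential equation ξ_η'(s) s² f''(s) − ξ_η(s)(2η + s f''(s)) = 1 for all s ∈ (0,∞). -/
open MeasureTheory Set

/-- The non-linearity `ξ_η`; for `η = 0` it coincides with `ξ`. -/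
noncomputable def xiEta (f : ℝ → ℝ) (η : ℝ) (s : ℝ) : ℝ :=
  -s * Real.exp (∫ y in Ioo (0:ℝ) s, 2 * η / (y ^ 2 * deriv (deriv f) y)) *
    ∫ y in Ioi s,
      Real.exp (-(∫ z in Ioo (0:ℝ) y, 2 * η / (z ^ 2 * deriv (deriv f) z))) *
        (1 / (y ^ 3 * deriv (deriv f) y))

lemma aux_left (h : ℝ → ℝ) (hc : ContinuousOn h (Ioi 0))
    (hi : ∀ s ∈ Ioi (0:ℝ), IntegrableOn h (Ioo 0 s)) (s : ℝ) (hs : 0 < s) :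
    HasDerivAt (fun t => ∫ y in Ioo (0:ℝ) t, h y) (h s) s := by
  have h1 : HasDerivAt (fun t => ∫ y in (0:ℝ)..t, h y) (h s) s := by
    apply intervalIntegral.integral_hasDerivAt_right
    · rw [intervalIntegrable_iff_integrableOn_Ioo_of_le hs.le]
      exact hi s hs
    · exact hc.stronglyMeasurableAtFilter isOpen_Ioi s hs
    · exact hc.continuousAt (Ioi_mem_nhds hs)
  refine h1.congr_of_eventuallyEq ?_
  filter_upwards [Ioi_mem_nhds hs] with t ht
  rw [intervalIntegral.integral_of_le (le_of_lt ht), integral_Ioc_eq_integral_Ioo]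

lemma aux_right (h : ℝ → ℝ) (hc : ContinuousOn h (Ioi 0))
    (hi : ∀ s ∈ Ioi (0:ℝ), IntegrableOn h (Ioi s)) (s : ℝ) (hs : 0 < s) :
    HasDerivAt (fun t => ∫ y in Ioi t, h y) (- h s) s := by
  have hs2 : 0 < s / 2 := by positivity
  have hs3 : s / 2 < s := by linarith
  have h1 : HasDerivAt (fun t => ∫ y in (s/2)..t, h y) (h s) s := by
    apply intervalIntegral.integral_hasDerivAt_right
    · rw [intervalIntegrable_iff_integrableOn_Ioo_of_le hs3.le]
      exact (hi (s/2) hs2).mono_set Ioo_subset_Ioi_self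
    · exact hc.stronglyMeasurableAtFilter isOpen_Ioi s hs
    · exact hc.continuousAt (Ioi_mem_nhds hs)
  refine (h1.const_sub (∫ y in Ioi (s/2), h y)).congr_of_eventuallyEq ?_
  filter_upwards [Ioi_mem_nhds hs3] with t ht
  have ht0 : 0 < t := lt_trans hs2 ht
  have := intervalIntegral.integral_interval_add_Ioi (hi (s/2) hs2) (hi t ht0)
  linarith

/-- for `f ∈ C²((0,∞))` with `f'' > 0` and the stated integrability
conditions, for every `η ≥ 0` the function `ξ_η` is continuously differentiable on
`(0,∞)` and satisfies `ξ_η'(s) s² f''(s) − ξ_η(s)(2η + s f''(s)) = 1` there. -/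
theorem xiEta_contDiff_and_ode (f : ℝ → ℝ)
    (hf : ContDiffOn ℝ 2 f (Ioi 0))
    (hf'' : ∀ s ∈ Ioi (0:ℝ), 0 < deriv (deriv f) s)
    (hint1 : ∀ s ∈ Ioi (0:ℝ),
      IntegrableOn (fun y => 1 / (y ^ 3 * deriv (deriv f) y)) (Ioi s))
    (hint2 : ∀ s ∈ Ioi (0:ℝ),
      IntegrableOn (fun y => 1 / (y ^ 2 * deriv (deriv f) y)) (Ioo 0 s))
    (η : ℝ) (hη : 0 ≤ η) :
    (∀ s ∈ Ioi (0:ℝ), DifferentiableAt ℝ (xiEta f η) s) ∧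
    ContinuousOn (deriv (xiEta f η)) (Ioi 0) ∧
    ∀ s ∈ Ioi (0:ℝ),
      deriv (xiEta f η) s * s ^ 2 * deriv (deriv f) s -
        xiEta f η s * (2 * η + s * deriv (deriv f) s) = 1 := by
  have hg : ContinuousOn (deriv (deriv f)) (Ioi 0) := by
    have h1 : ContDiffOn ℝ 1 (deriv f) (Ioi 0) :=
      hf.deriv_of_isOpen isOpen_Ioi (by norm_num)
    exact h1.continuousOn_deriv_of_isOpen isOpen_Ioi (by norm_num)
  generalize hgg : deriv (deriv f) = g at *
  have hne : ∀ s ∈ Ioi (0:ℝ), g s ≠ 0 := fun s hs => (hf'' s hs).ne'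
  have hc2 : ContinuousOn (fun y => 2 * η / (y ^ 2 * g y)) (Ioi 0) := by
    refine ContinuousOn.div (by fun_prop) (by fun_prop) fun y hy => ?_
    exact mul_ne_zero (pow_ne_zero _ (ne_of_gt hy)) (hne y hy)
  have hc3 : ContinuousOn (fun y => 1 / (y ^ 3 * g y)) (Ioi 0) := by
    refine ContinuousOn.div (by fun_prop) (by fun_prop) fun y hy => ?_
    exact mul_ne_zero (pow_ne_zero _ (ne_of_gt hy)) (hne y hy)
  have hi2 : ∀ s ∈ Ioi (0:ℝ), IntegrableOn (fun y => 2 * η / (y ^ 2 * g y)) (Ioo 0 s) := by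
    intro s hs
    have := (hint2 s hs).const_mul (2 * η)
    simp only [mul_one_div] at this
    exact this
  have hA := aux_left _ hc2 hi2
  have hA0 : ∀ s : ℝ, 0 ≤ ∫ y in Ioo (0:ℝ) s, 2 * η / (y ^ 2 * g y) := by
    intro s
    refine setIntegral_nonneg measurableSet_Ioo fun y hy => ?_
    have := hf'' y hy.1
    positivity
  have hxi : xiEta f η = fun s => -s * Real.exp (∫ y in Ioo (0:ℝ) s, 2 * η / (y ^ 2 * g y)) *
    ∫ y in Ioi s,
      Real.exp (-(∫ z in Ioo (0:ℝ) y, 2 * η / (z ^ 2 * g z))) *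
        (1 / (y ^ 3 * g y)) := by
    funext s
    rw [xiEta, hgg]
  generalize hAA : (fun t : ℝ => ∫ y in Ioo (0:ℝ) t, 2 * η / (y ^ 2 * g y)) = A at hA
  have hAt : ∀ t : ℝ, (∫ y in Ioo (0:ℝ) t, 2 * η / (y ^ 2 * g y)) = A t :=
    fun t => congrFun hAA t
  simp only [hAt] at hxi hA0
  have hAc : ContinuousOn A (Ioi 0) := fun s hs => (hA s hs).continuousAt.continuousWithinAt
  have hkc : ContinuousOn (fun y => Real.exp (-(A y)) * (1 / (y ^ 3 * g y))) (Ioi 0) :=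
    (Real.continuous_exp.comp_continuousOn hAc.neg).mul hc3
  have hki : ∀ s ∈ Ioi (0:ℝ),
      IntegrableOn (fun y => Real.exp (-(A y)) * (1 / (y ^ 3 * g y))) (Ioi s) := by
    intro s hs
    refine Integrable.mono (hint1 s hs) ?_ ?_
    · exact (hkc.mono (Ioi_subset_Ioi (le_of_lt hs))).aestronglyMeasurable measurableSet_Ioi
    · refine Filter.Eventually.of_forall fun y => ?_
      rw [norm_mul]
      refine mul_le_of_le_one_left (norm_nonneg _) ?_
      rw [Real.norm_eq_abs, Real.abs_exp, Real.exp_le_one_iff]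
      linarith [hA0 y]
  have hI := aux_right _ hkc hki
  have hd : ∀ s ∈ Ioi (0:ℝ), HasDerivAt (xiEta f η)
      ((1 + xiEta f η s * (2 * η + s * g s)) / (s ^ 2 * g s)) s := by
    intro s hs
    have h := (((hasDerivAt_id s).neg.mul (hA s hs).exp).mul (hI s hs))
    rw [hxi]
    refine h.congr_deriv ?_
    have hs0 : s ≠ 0 := ne_of_gt hs
    have hgs := hne s hs
    have he : Real.exp (A s) * Real.exp (-(A s)) = 1 := by
      rw [← Real.exp_add]; simp
    simp only [Pi.neg_apply, Pi.mul_apply, id]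
    generalize (∫ y in Ioi s, Real.exp (-(A y)) * (1 / (y ^ 3 * g y))) = J
    generalize Real.exp (-(A s)) = E' at *
    generalize Real.exp (A s) = E at *
    field_simp
    linear_combination he
  refine ⟨fun s hs => (hd s hs).differentiableAt, ?_, ?_⟩
  · have hxc : ContinuousOn (xiEta f η) (Ioi 0) :=
      fun s hs => (hd s hs).continuousAt.continuousWithinAt
    refine ContinuousOn.congr (f := fun s => (1 + xiEta f η s * (2 * η + s * g s)) / (s ^ 2 * g s))
      ?_ (fun s hs => (hd s hs).deriv)
    refine ContinuousOn.div (by fun_prop) (by fun_prop) fun y hy => ?_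
    exact mul_ne_zero (pow_ne_zero _ (ne_of_gt hy)) (hne y hy)
  · intro s hs
    rw [(hd s hs).deriv]
    have hs0 : s ≠ 0 := ne_of_gt hs
    have hgs := hne s hs
    field_simp
    ring
end

section
/- Assume f satisfies Hypothesis (H2). Then for every η ∈ (0,1] and every s ∈ (0,∞): (i) |ξ_η(s)| ≤ |ξ(s)|; (ii) |ξ_η'(s)| ≤ |ξ(s)|/s + 1/(s² f''(s)) + 2η|ξ(s)|/(s² f''(s)); and (iii) |ξ_η''(s) f''(s) s²| ≤ 2η|ξ_η'(s)| + (1 + 2η|ξ(s)|)·|(d/ds) log(s f''(s))|. -/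
open MeasureTheory Set

/-- Hypothesis (H2): `f ∈ C⁴((0,∞))`, `f'' > 0`, `(1/(ακ)) s^α ≤ s² f''(s)` and
`|s f'''(s)/f''(s)| ≤ κ` on `(0,∞)`, with `α ∈ (0,1)`, `κ > 0`. -/
def HypH2 (f : ℝ → ℝ) (α κ : ℝ) : Prop :=
  ContDiffOn ℝ 4 f (Ioi 0) ∧
  (∀ s ∈ Ioi (0:ℝ), 0 < deriv (deriv f) s) ∧
  α ∈ Ioo (0:ℝ) 1 ∧ 0 < κ ∧
  (∀ s ∈ Ioi (0:ℝ), s ^ α / (α * κ) ≤ s ^ 2 * deriv (deriv f) s) ∧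
  (∀ s ∈ Ioi (0:ℝ), |s * deriv (deriv (deriv f)) s / deriv (deriv f) s| ≤ κ)

section aux

lemma aux_Ioi_deriv (k : ℝ → ℝ) (hk : ContinuousOn k (Ioi 0))
    (hint : ∀ s, 0 < s → IntegrableOn k (Ioi s)) (s : ℝ) (hs : 0 < s) :
    HasDerivAt (fun t => ∫ y in Ioi t, k y) (- k s) s := by
  have h2 : 0 < s / 2 := by linarith
  have hsm : s / 2 < s := by linarith
  have hD : HasDerivAt (fun t => ∫ y in (s/2)..t, k y) (k s) s := by
    refine intervalIntegral.integral_hasDerivAt_right ?_ ?_ (hk.continuousAt (Ioi_mem_nhds hs))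
    · apply ContinuousOn.intervalIntegrable
      apply hk.mono
      intro x hx
      rw [uIcc_of_le hsm.le] at hx
      exact lt_of_lt_of_le h2 hx.1
    · exact hk.stronglyMeasurableAtFilter isOpen_Ioi s hs
  have h3 := hD.const_sub (∫ y in Ioi (s/2), k y)
  refine h3.congr_of_eventuallyEq ?_
  filter_upwards [Ioi_mem_nhds hsm] with t ht
  have := intervalIntegral.integral_interval_add_Ioi (μ := volume) (hint _ h2)
    (hint t (lt_trans h2 ht))
  linarith

lemma aux_Ioo_deriv (k : ℝ → ℝ) (hk : ContinuousOn k (Ioi 0))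
    (hint : ∀ s, 0 < s → IntegrableOn k (Ioo 0 s)) (s : ℝ) (hs : 0 < s) :
    HasDerivAt (fun t => ∫ y in Ioo 0 t, k y) (k s) s := by
  have hD : HasDerivAt (fun t => ∫ y in (0:ℝ)..t, k y) (k s) s := by
    refine intervalIntegral.integral_hasDerivAt_right ?_ ?_ (hk.continuousAt (Ioi_mem_nhds hs))
    · rw [intervalIntegrable_iff_integrableOn_Ioo_of_le hs.le]
      exact hint s hs
    · exact hk.stronglyMeasurableAtFilter isOpen_Ioi s hs
  refine hD.congr_of_eventuallyEq ?_
  filter_upwards [Ioi_mem_nhds hs] with t ht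
  rw [intervalIntegral.integral_of_le (le_of_lt ht), integral_Ioc_eq_integral_Ioo]

lemma aux_bound (f : ℝ → ℝ) (α κ : ℝ) (hf : HypH2 f α κ) (y : ℝ) (hy : 0 < y) :
    1 / (y ^ 2 * deriv (deriv f) y) ≤ α * κ * y ^ (-α) := by
  obtain ⟨-, hp, hα, hκ, hb, -⟩ := hf
  have h1 := hb y hy
  have h0 : 0 < y ^ α := Real.rpow_pos_of_pos hy _
  have h3 : 0 < α * κ := mul_pos hα.1 hκ
  calc 1 / (y ^ 2 * deriv (deriv f) y) ≤ 1 / (y ^ α / (α * κ)) :=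
        one_div_le_one_div_of_le (by positivity) h1
    _ = _ := by rw [Real.rpow_neg hy.le]; field_simp

lemma aux_reg (f : ℝ → ℝ) (α κ : ℝ) (hf : HypH2 f α κ) :
    DifferentiableOn ℝ (deriv (deriv f)) (Ioi 0) := by
  have h1 : ContDiffOn ℝ 3 (deriv f) (Ioi 0) := hf.1.deriv_of_isOpen isOpen_Ioi (by norm_num)
  have h2 : ContDiffOn ℝ 2 (deriv (deriv f)) (Ioi 0) := h1.deriv_of_isOpen isOpen_Ioi (by norm_num)
  exact h2.differentiableOn (by norm_num)

lemma aux_cont (f : ℝ → ℝ) (α κ : ℝ) (hf : HypH2 f α κ) (n : ℕ) :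
    ContinuousOn (fun y => 1 / (y ^ n * deriv (deriv f) y)) (Ioi 0) := by
  have := (aux_reg f α κ hf).continuousOn
  refine continuousOn_const.div ((continuousOn_id.pow n).mul this) ?_
  intro x hx
  exact (mul_pos (pow_pos hx n) (hf.2.1 x hx)).ne'

lemma aux_int0 (f : ℝ → ℝ) (α κ : ℝ) (hf : HypH2 f α κ) (s : ℝ) (hs : 0 < s) :
    IntegrableOn (fun y => 1 / (y ^ 2 * deriv (deriv f) y)) (Ioo 0 s) := by
  have h1 : IntegrableOn (fun y : ℝ => α * κ * y ^ (-α)) (Ioo 0 s) := by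
    have := intervalIntegral.intervalIntegrable_rpow' (a := 0) (b := s) (r := -α)
      (by linarith [hf.2.2.1.2])
    rw [intervalIntegrable_iff_integrableOn_Ioo_of_le hs.le] at this
    exact this.const_mul _
  refine Integrable.mono' h1 ?_ ?_
  · exact ((aux_cont f α κ hf 2).mono Ioo_subset_Ioi_self).aestronglyMeasurable measurableSet_Ioo
  · filter_upwards [ae_restrict_mem measurableSet_Ioo] with y hy
    have := hf.2.1 y hy.1
    have hy0 := hy.1
    rw [Real.norm_of_nonneg (by positivity)]
    exact aux_bound f α κ hf y hy.1

lemma aux_int1 (f : ℝ → ℝ) (α κ : ℝ) (hf : HypH2 f α κ) (s : ℝ) (hs : 0 < s) :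
    IntegrableOn (fun y => 1 / (y ^ 3 * deriv (deriv f) y)) (Ioi s) := by
  have h1 : IntegrableOn (fun y : ℝ => α * κ * y ^ (-α - 1)) (Ioi s) :=
    (integrableOn_Ioi_rpow_of_lt (by linarith [hf.2.2.1.1]) hs).const_mul _
  refine Integrable.mono' h1 ?_ ?_
  · exact ((aux_cont f α κ hf 3).mono (Ioi_subset_Ioi hs.le)).aestronglyMeasurable measurableSet_Ioi
  · filter_upwards [ae_restrict_mem measurableSet_Ioi] with y hy
    have hy0 : 0 < y := lt_trans hs hy
    have := hf.2.1 y hy0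
    rw [Real.norm_of_nonneg (by positivity)]
    have h2 := aux_bound f α κ hf y hy0
    rw [Real.rpow_sub_one hy0.ne']
    calc 1 / (y ^ 3 * deriv (deriv f) y) = 1 / (y ^ 2 * deriv (deriv f) y) / y := by field_simp
      _ ≤ α * κ * y ^ (-α) / y := by gcongr
      _ = _ := by ring

noncomputable def auxG (f : ℝ → ℝ) (η s : ℝ) : ℝ :=
  ∫ y in Ioo (0:ℝ) s, 2 * η / (y ^ 2 * deriv (deriv f) y)

lemma auxG_deriv (f : ℝ → ℝ) (α κ : ℝ) (hf : HypH2 f α κ) (η s : ℝ) (hs : 0 < s) :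
    HasDerivAt (auxG f η) (2 * η / (s ^ 2 * deriv (deriv f) s)) s := by
  have e : ∀ y, 2 * η / (y ^ 2 * deriv (deriv f) y)
      = 2 * η * (1 / (y ^ 2 * deriv (deriv f) y)) := fun y => by ring
  refine aux_Ioo_deriv (fun y => 2 * η / (y ^ 2 * deriv (deriv f) y)) ?_ ?_ s hs
  · simp_rw [e]
    exact continuousOn_const.mul (aux_cont f α κ hf 2)
  · intro t ht
    simp_rw [e]
    exact (aux_int0 f α κ hf t ht).const_mul _

lemma auxG_mono (f : ℝ → ℝ) (α κ : ℝ) (hf : HypH2 f α κ) (η : ℝ) (hη : 0 ≤ η) :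
    MonotoneOn (auxG f η) (Ioi 0) := by
  refine monotoneOn_of_deriv_nonneg (convex_Ioi 0)
    (fun x hx => (auxG_deriv f α κ hf η x hx).continuousAt.continuousWithinAt) ?_ ?_
  · rw [interior_Ioi]
    exact fun x hx => (auxG_deriv f α κ hf η x hx).differentiableAt.differentiableWithinAt
  · rw [interior_Ioi]
    intro x hx
    rw [(auxG_deriv f α κ hf η x hx).deriv]
    have := hf.2.1 x hx
    have hx' : 0 < x := hx
    positivity

lemma auxG_nonneg (f : ℝ → ℝ) (α κ : ℝ) (hf : HypH2 f α κ) (η : ℝ) (hη : 0 ≤ η) (s : ℝ) :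
    0 ≤ auxG f η s := by
  refine setIntegral_nonneg measurableSet_Ioo ?_
  intro x hx
  have := hf.2.1 x hx.1
  have hx' : 0 < x := hx.1
  positivity

lemma aux_cont2 (f : ℝ → ℝ) (α κ : ℝ) (hf : HypH2 f α κ) (η : ℝ) :
    ContinuousOn (fun y => Real.exp (-(auxG f η y)) * (1 / (y ^ 3 * deriv (deriv f) y)))
      (Ioi 0) := by
  have h : ContinuousOn (auxG f η) (Ioi 0) :=
    fun x hx => (auxG_deriv f α κ hf η x hx).continuousAt.continuousWithinAt
  exact h.neg.rexp.mul (aux_cont f α κ hf 3)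

lemma aux_int2 (f : ℝ → ℝ) (α κ : ℝ) (hf : HypH2 f α κ) (η : ℝ) (hη : 0 ≤ η)
    (s : ℝ) (hs : 0 < s) :
    IntegrableOn (fun y => Real.exp (-(auxG f η y)) * (1 / (y ^ 3 * deriv (deriv f) y)))
      (Ioi s) := by
  refine Integrable.mono' (aux_int1 f α κ hf s hs) ?_ ?_
  · exact ((aux_cont2 f α κ hf η).mono (Ioi_subset_Ioi hs.le)).aestronglyMeasurable
      measurableSet_Ioi
  · filter_upwards [ae_restrict_mem measurableSet_Ioi] with y hy
    have hy0 : 0 < y := lt_trans hs hy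
    have := hf.2.1 y hy0
    rw [Real.norm_of_nonneg (by positivity)]
    refine mul_le_of_le_one_left (by positivity) ?_
    rw [Real.exp_le_one_iff]
    linarith [auxG_nonneg f α κ hf η hη y]

lemma xiEta_eq (f : ℝ → ℝ) (η s : ℝ) : xiEta f η s = -s * Real.exp (auxG f η s) *
    ∫ y in Ioi s, Real.exp (-(auxG f η y)) * (1 / (y ^ 3 * deriv (deriv f) y)) := rfl

lemma xiEta_zero (f : ℝ → ℝ) (s : ℝ) : xiEta f 0 s = -s *
    ∫ y in Ioi s, (1 / (y ^ 3 * deriv (deriv f) y)) := by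
  simp [xiEta]

lemma xiEta_abs_le (f : ℝ → ℝ) (α κ : ℝ) (hf : HypH2 f α κ) (η : ℝ) (hη : 0 ≤ η)
    (s : ℝ) (hs : 0 < s) : |xiEta f η s| ≤ |xiEta f 0 s| := by
  rw [xiEta_eq, xiEta_zero, mul_assoc, abs_mul (-s), abs_mul (-s)]
  refine mul_le_mul_of_nonneg_left ?_ (abs_nonneg _)
  rw [← integral_const_mul]
  have hpos : ∀ y ∈ Ioi s, 0 ≤ 1 / (y ^ 3 * deriv (deriv f) y) := by
    intro y hy
    have hy0 : 0 < y := lt_trans hs hy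
    have := hf.2.1 y hy0
    positivity
  refine abs_le_abs_of_nonneg ?_ ?_
  · refine setIntegral_nonneg measurableSet_Ioi ?_
    intro y hy
    have := hpos y hy
    positivity
  · refine setIntegral_mono_on ((aux_int2 f α κ hf η hη s hs).const_mul _)
      (aux_int1 f α κ hf s hs) measurableSet_Ioi ?_
    intro y hy
    rw [← mul_assoc, ← Real.exp_add]
    refine mul_le_of_le_one_left (hpos y hy) ?_
    rw [Real.exp_le_one_iff]
    have := auxG_mono f α κ hf η hη (show s ∈ Ioi (0:ℝ) from hs) (lt_trans hs hy) (le_of_lt hy)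
    linarith

lemma xiEta_deriv (f : ℝ → ℝ) (α κ : ℝ) (hf : HypH2 f α κ) (η : ℝ) (hη : 0 ≤ η)
    (s : ℝ) (hs : 0 < s) : HasDerivAt (xiEta f η)
      (xiEta f η s / s + (1 + 2 * η * xiEta f η s) / (s ^ 2 * deriv (deriv f) s)) s := by
  have hG := (auxG_deriv f α κ hf η s hs).exp
  have hI := aux_Ioi_deriv _ (aux_cont2 f α κ hf η) (aux_int2 f α κ hf η hη) s hs
  have h := ((hasDerivAt_id s).neg.mul hG).mul hI
  have hp := hf.2.1 s hs
  refine h.congr_deriv ?_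
  rw [xiEta_eq]
  simp only [Pi.mul_apply, Pi.neg_apply, id, Real.exp_neg]
  have := (Real.exp_pos (auxG f η s)).ne'
  field_simp
  ring

lemma xiEta_deriv2 (f : ℝ → ℝ) (α κ : ℝ) (hf : HypH2 f α κ) (η : ℝ) (hη : 0 ≤ η)
    (s : ℝ) (hs : 0 < s) : deriv (deriv (xiEta f η)) s * deriv (deriv f) s * s ^ 2 =
      2 * η * deriv (xiEta f η) s - (1 + 2 * η * xiEta f η s) *
        deriv (fun y => Real.log (y * deriv (deriv f) y)) s := by
  have hp := hf.2.1 s hs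
  have hh : HasDerivAt (deriv (deriv f)) (deriv (deriv (deriv f)) s) s :=
    ((aux_reg f α κ hf).differentiableAt (Ioi_mem_nhds hs)).hasDerivAt
  have hx := xiEta_deriv f α κ hf η hη s hs
  have hl := ((hasDerivAt_id s).mul hh).log (mul_pos hs hp).ne'
  have hl' : deriv (fun y => Real.log (y * deriv (deriv f) y)) s =
    (1 * deriv (deriv f) s + s * deriv (deriv (deriv f)) s) / (s * deriv (deriv f) s) := hl.deriv
  have he : deriv (xiEta f η) =ᶠ[nhds s] fun t =>
      xiEta f η t / t + (1 + 2 * η * xiEta f η t) / (t ^ 2 * deriv (deriv f) t) := by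
    filter_upwards [Ioi_mem_nhds hs] with t ht
    exact (xiEta_deriv f α κ hf η hη t ht).deriv
  have h2 := (hx.div (hasDerivAt_id s) hs.ne').add
    (((hx.const_mul (2 * η)).const_add 1).div (((hasDerivAt_id s).pow 2).mul hh)
      (mul_pos (pow_pos hs 2) hp).ne')
  have h3 := (h2.congr_of_eventuallyEq he).deriv
  rw [h3, hl', hx.deriv]
  simp only [Pi.mul_apply, Pi.pow_apply, id]
  field_simp
  ring

end aux



/-- comparison of `ξ_η`, `ξ_η'`, `ξ_η''` with `ξ = ξ_0`. -/
theorem xiEta_bounds_by_xi (f : ℝ → ℝ) (α κ : ℝ) (hf : HypH2 f α κ)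
    (η : ℝ) (hη : η ∈ Ioc (0:ℝ) 1) :
    ∀ s ∈ Ioi (0:ℝ),
      |xiEta f η s| ≤ |xiEta f 0 s| ∧
      |deriv (xiEta f η) s| ≤
        |xiEta f 0 s| / s + 1 / (s ^ 2 * deriv (deriv f) s) +
          2 * η * |xiEta f 0 s| / (s ^ 2 * deriv (deriv f) s) ∧
      |deriv (deriv (xiEta f η)) s * deriv (deriv f) s * s ^ 2| ≤
        2 * η * |deriv (xiEta f η) s| +
          (1 + 2 * η * |xiEta f 0 s|) *
            |deriv (fun y => Real.log (y * deriv (deriv f) y)) s| := by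
  intro s hs
  have hs0 : 0 < s := hs
  have hη0 : 0 ≤ η := hη.1.le
  have hp := hf.2.1 s hs
  have h1 := xiEta_abs_le f α κ hf η hη0 s hs0
  have hA : |1 + 2 * η * xiEta f η s| ≤ 1 + 2 * η * |xiEta f 0 s| := by
    calc |1 + 2 * η * xiEta f η s| ≤ |1| + |2 * η * xiEta f η s| := abs_add_le _ _
      _ = 1 + 2 * η * |xiEta f η s| := by
        rw [abs_mul, abs_one, abs_of_nonneg (by positivity : 0 ≤ 2 * η)]
      _ ≤ _ := by gcongr
  refine ⟨h1, ?_, ?_⟩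
  · rw [(xiEta_deriv f α κ hf η hη0 s hs0).deriv]
    calc _ ≤ |xiEta f η s / s| + |(1 + 2 * η * xiEta f η s) / (s ^ 2 * deriv (deriv f) s)| :=
          abs_add_le _ _
      _ = |xiEta f η s| / s + |1 + 2 * η * xiEta f η s| / (s ^ 2 * deriv (deriv f) s) := by
        rw [abs_div, abs_div, abs_of_pos hs0,
          abs_of_pos (by positivity : 0 < s ^ 2 * deriv (deriv f) s)]
      _ ≤ |xiEta f 0 s| / s + (1 + 2 * η * |xiEta f 0 s|) / (s ^ 2 * deriv (deriv f) s) := by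
        gcongr
      _ = _ := by ring
  · rw [xiEta_deriv2 f α κ hf η hη0 s hs0]
    refine (abs_sub _ _).trans ?_
    rw [abs_mul, abs_mul (1 + 2 * η * xiEta f η s), abs_of_nonneg (by positivity : 0 ≤ 2 * η)]
    gcongr
end

section
/- Assume f satisfies Hypothesis (H2) with constants α ∈ (0,1) and κ > 0. Then for every η ∈ (0,1] and every s ∈ (0,∞): (i) |ξ_η(s)| ≤ κ s^{1−α}; (ii) |ξ_η'(s)| ≤ (1+α) κ s^{−α} + 2ηακ² s^{1−2α}; and (iii) |ξ_η''(s) f''(s) s²| ≤ (κ+1) s^{−1} + 2ηκ(2+α+κ) s^{−α} + 4αη²κ² s^{1−2α}. -/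
open MeasureTheory Set

lemma xi_aux_E (F : ℝ → ℝ) (α κ η : ℝ) (hd : ∀ s ∈ Ioi (0:ℝ), DifferentiableAt ℝ F s)
    (hpos : ∀ s ∈ Ioi (0:ℝ), 0 < F s) (hα : α ∈ Ioo (0:ℝ) 1) (hκ : 0 < κ)
    (hlow : ∀ s ∈ Ioi (0:ℝ), s ^ α / (α * κ) ≤ s ^ 2 * F s) (hη : 0 < η) :
    ∃ E : ℝ → ℝ, (∀ s, -s * Real.exp (∫ y in Ioo (0:ℝ) s, 2 * η / (y ^ 2 * F y)) *
      (∫ y in Ioi s, Real.exp (-(∫ z in Ioo (0:ℝ) y, 2 * η / (z ^ 2 * F z))) *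
        (1 / (y ^ 3 * F y))) = - s * E s) ∧ ∀ s ∈ Ioi (0:ℝ), 0 ≤ E s ∧ E s ≤ κ * s ^ (-α) ∧
      HasDerivAt E (2 * η * E s / (s ^ 2 * F s) - 1 / (s ^ 3 * F s)) s := by
  obtain ⟨hα0, hα1⟩ := hα
  have hFc : ContinuousOn F (Ioi 0) := fun s hs => (hd s hs).continuousAt.continuousWithinAt
  have hinv : ∀ s ∈ Ioi (0:ℝ), 1 / (s ^ 2 * F s) ≤ α * κ * s ^ (-α) := by
    intro s hs
    have h1 : 0 < s ^ α := Real.rpow_pos_of_pos hs α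
    have h := one_div_le_one_div_of_le (by positivity) (hlow s hs)
    rw [Real.rpow_neg (le_of_lt hs)]
    refine h.trans (le_of_eq ?_)
    rw [one_div_div, div_eq_mul_inv]
  have hac : ContinuousOn (fun y => 2 * η / (y ^ 2 * F y)) (Ioi 0) := by
    refine ContinuousOn.div continuousOn_const (by fun_prop) ?_
    intro x hx
    have := hpos x hx
    have h2 : (0:ℝ) < x := hx
    positivity
  have ha0 : ∀ y ∈ Ioi (0:ℝ), 0 ≤ 2 * η / (y ^ 2 * F y) := by
    intro x hx
    have := hpos x hx
    have h2 : (0:ℝ) < x := hx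
    positivity
  have hai : ∀ s ∈ Ioi (0:ℝ), IntegrableOn (fun y => 2 * η / (y ^ 2 * F y)) (Ioc 0 s) := by
    intro s hs
    have h1 : IntegrableOn (fun x : ℝ => 2 * η * (α * κ) * x ^ (-α)) (Ioc 0 s) := by
      have := (intervalIntegral.intervalIntegrable_rpow' (a := 0) (b := s)
        (r := -α) (by linarith)).const_mul (2 * η * (α * κ))
      rwa [intervalIntegrable_iff_integrableOn_Ioc_of_le (le_of_lt hs)] at this
    refine Integrable.mono' h1
      ((hac.mono Ioc_subset_Ioi_self).aestronglyMeasurable measurableSet_Ioc) ?_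
    filter_upwards [ae_restrict_mem measurableSet_Ioc] with x hx
    rw [Real.norm_of_nonneg (ha0 x hx.1)]
    have := mul_le_mul_of_nonneg_left (hinv x hx.1) (by positivity : 0 ≤ 2 * η)
    calc _ = 2 * η * (1 / (x ^ 2 * F x)) := by ring
      _ ≤ _ := this
      _ = _ := by ring
  set A : ℝ → ℝ := fun s => ∫ y in Ioo (0:ℝ) s, 2 * η / (y ^ 2 * F y) with hA
  have hAd : ∀ s ∈ Ioi (0:ℝ), HasDerivAt A (2 * η / (s ^ 2 * F s)) s := by
    intro s hs
    have h1 := intervalIntegral.integral_hasDerivAt_right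
      ((intervalIntegrable_iff_integrableOn_Ioc_of_le (le_of_lt hs)).2 (hai s hs))
      (hac.stronglyMeasurableAtFilter isOpen_Ioi s hs) (hac.continuousAt (Ioi_mem_nhds hs))
    refine h1.congr_of_eventuallyEq ?_
    filter_upwards [Ioi_mem_nhds hs] with t ht
    rw [intervalIntegral.integral_of_le (le_of_lt ht), integral_Ioc_eq_integral_Ioo]
  have hAm : ∀ s ∈ Ioi (0:ℝ), ∀ y, s ≤ y → A s ≤ A y := by
    intro s hs y hy
    refine setIntegral_mono_set
      ((hai y (lt_of_lt_of_le hs hy)).mono_set Ioo_subset_Ioc_self) ?_ ?_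
    · filter_upwards [ae_restrict_mem measurableSet_Ioo] with x hx using ha0 x hx.1
    · exact (Ioo_subset_Ioo_right hy).eventuallyLE
  have hAc : ContinuousOn A (Ioi 0) := fun s hs => (hAd s hs).continuousAt.continuousWithinAt
  set j : ℝ → ℝ := fun y => Real.exp (-(A y)) * (1 / (y ^ 3 * F y)) with hj
  have hjc : ContinuousOn j (Ioi 0) := by
    refine ContinuousOn.mul (by fun_prop) (ContinuousOn.div continuousOn_const (by fun_prop) ?_)
    intro x hx
    have := hpos x hx
    have h2 : (0:ℝ) < x := hx
    positivity
  have hj0 : ∀ y ∈ Ioi (0:ℝ), 0 ≤ j y := by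
    intro x hx
    have := hpos x hx
    have h2 : (0:ℝ) < x := hx
    simp only [hj]
    positivity
  have hjb : ∀ s ∈ Ioi (0:ℝ), ∀ y, s ≤ y →
      j y ≤ Real.exp (-(A s)) * (α * κ) * y ^ (-1 - α) := by
    intro s hs y hy
    have hy0 : (0:ℝ) < y := lt_of_lt_of_le hs hy
    have hF := hpos y hy0
    have h1 : Real.exp (-(A y)) ≤ Real.exp (-(A s)) :=
      Real.exp_le_exp.2 (neg_le_neg (hAm s hs y hy))
    have h2 : 1 / (y ^ 3 * F y) ≤ α * κ * y ^ (-1 - α) := by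
      have := mul_le_mul_of_nonneg_left (hinv y hy0) (by positivity : 0 ≤ 1 / y)
      calc _ = 1 / y * (1 / (y ^ 2 * F y)) := by field_simp
        _ ≤ _ := this
        _ = _ := by
          rw [sub_eq_add_neg, Real.rpow_add hy0, Real.rpow_neg_one]; ring
    calc j y ≤ Real.exp (-(A s)) * (α * κ * y ^ (-1 - α)) := by
          simp only [hj]
          exact mul_le_mul h1 h2 (by positivity) (by positivity)
      _ = _ := by ring
  have hri : ∀ s ∈ Ioi (0:ℝ), IntegrableOn
      (fun y : ℝ => Real.exp (-(A s)) * (α * κ) * y ^ (-1 - α)) (Ioi s) := by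
    intro s hs
    exact (integrableOn_Ioi_rpow_of_lt (by linarith) hs).const_mul _
  have hji : ∀ s ∈ Ioi (0:ℝ), IntegrableOn j (Ioi s) := by
    intro s hs
    have hsub : Ioi s ⊆ Ioi (0:ℝ) := Ioi_subset_Ioi (le_of_lt hs)
    refine Integrable.mono' (hri s hs)
      ((hjc.mono hsub).aestronglyMeasurable measurableSet_Ioi) ?_
    filter_upwards [ae_restrict_mem measurableSet_Ioi] with x hx
    rw [Real.norm_of_nonneg (hj0 x (hsub hx))]
    exact hjb s hs x (le_of_lt hx)
  have hJd : ∀ s ∈ Ioi (0:ℝ), HasDerivAt (fun t => ∫ y in Ioi t, j y) (-j s) s := by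
    intro s hs
    have hs0 : (0:ℝ) < s := hs
    have hs2 : (0:ℝ) < s / 2 := by positivity
    have hlt : s / 2 < s := by linarith
    have h1 := intervalIntegral.integral_hasDerivAt_right (a := s / 2)
      ((intervalIntegrable_iff_integrableOn_Ioc_of_le hlt.le).2
        ((hji (s / 2) hs2).mono_set Ioc_subset_Ioi_self))
      (hjc.stronglyMeasurableAtFilter isOpen_Ioi s hs) (hjc.continuousAt (Ioi_mem_nhds hs))
    refine (h1.const_sub (∫ y in Ioi (s / 2), j y)).congr_of_eventuallyEq ?_
    filter_upwards [Ioi_mem_nhds hlt] with t ht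
    rw [← intervalIntegral.integral_Ioi_sub_Ioi (hji (s / 2) hs2) (le_of_lt ht)]
    ring
  refine ⟨fun s => Real.exp (A s) * ∫ y in Ioi s, j y, fun s => by simp only [hj]; ring, ?_⟩
  intro s hs
  have hs0 : (0:ℝ) < s := hs
  have hF := hpos s hs
  refine ⟨?_, ?_, ?_⟩
  · refine mul_nonneg (Real.exp_pos _).le (setIntegral_nonneg measurableSet_Ioi ?_)
    intro y hy
    exact hj0 y (lt_trans hs0 hy)
  · have h1 : ∫ y in Ioi s, j y ≤ ∫ y in Ioi s, Real.exp (-(A s)) * (α * κ) * y ^ (-1 - α) :=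
      setIntegral_mono_on (hji s hs) (hri s hs) measurableSet_Ioi
        (fun y hy => hjb s hs y (le_of_lt hy))
    rw [integral_const_mul, integral_Ioi_rpow_of_lt (by linarith) hs0] at h1
    have h2 := mul_le_mul_of_nonneg_left h1 (Real.exp_pos (A s)).le
    refine h2.trans (le_of_eq ?_)
    rw [show -1 - α + 1 = -α by ring, Real.exp_neg]
    field_simp
  · have h := (hAd s hs).exp.mul (hJd s hs)
    refine h.congr_deriv ?_
    simp only [hj]
    rw [Real.exp_neg]
    field_simp
    ring

/-- power-law bounds on `ξ_η`, `ξ_η'`, `ξ_η''` under Hypothesis (H2). -/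
theorem xiEta_power_bounds (f : ℝ → ℝ) (α κ : ℝ) (hf : HypH2 f α κ)
    (η : ℝ) (hη : η ∈ Ioc (0:ℝ) 1) :
    ∀ s ∈ Ioi (0:ℝ),
      |xiEta f η s| ≤ κ * s ^ (1 - α) ∧
      |deriv (xiEta f η) s| ≤
        (1 + α) * κ * s ^ (-α) + 2 * η * α * κ ^ 2 * s ^ (1 - 2 * α) ∧
      |deriv (deriv (xiEta f η)) s * deriv (deriv f) s * s ^ 2| ≤
        (κ + 1) * s ^ (-1 : ℝ) + 2 * η * κ * (2 + α + κ) * s ^ (-α) +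
          4 * α * η ^ 2 * κ ^ 2 * s ^ (1 - 2 * α) := by
  obtain ⟨hC, hpos, hα, hκ, hlow, hthree⟩ := hf
  obtain ⟨hη0, hη1⟩ := hη
  have hC1 : ContDiffOn ℝ 3 (deriv f) (Ioi 0) := hC.deriv_of_isOpen isOpen_Ioi (by norm_num)
  have hC2 : ContDiffOn ℝ 2 (deriv (deriv f)) (Ioi 0) :=
    hC1.deriv_of_isOpen isOpen_Ioi (by norm_num)
  have hd : ∀ s ∈ Ioi (0:ℝ), DifferentiableAt ℝ (deriv (deriv f)) s := fun s hs =>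
    (hC2.differentiableOn (by norm_num)).differentiableAt (Ioi_mem_nhds hs)
  obtain ⟨E, hE, hEs⟩ := xi_aux_E (deriv (deriv f)) α κ η hd hpos hα hκ hlow hη0
  have hxi : xiEta f η = fun s => -s * E s := funext hE
  obtain ⟨hα0, hα1⟩ := hα
  generalize deriv (deriv f) = F at *
  have hD : ∀ s ∈ Ioi (0:ℝ), deriv (xiEta f η) s =
      -E s - 2 * η * s * E s / (s ^ 2 * F s) + 1 / (s ^ 2 * F s) := by
    intro s hs
    have hs0 : (0:ℝ) < s := hs
    have hF := hpos s hs
    rw [hxi]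
    refine (((hasDerivAt_id s).neg.mul (hEs s hs).2.2).congr_deriv ?_).deriv
    simp only [id, Pi.neg_apply]
    field_simp
    ring
  intro s hs
  have hs0 : (0:ℝ) < s := hs
  have hF := hpos s hs
  have hg : 0 < s ^ 2 * F s := by positivity
  obtain ⟨hE0, hE1, hE2⟩ := hEs s hs
  have hP : 0 < s ^ (-α) := Real.rpow_pos_of_pos hs0 _
  have hinv : 1 / (s ^ 2 * F s) ≤ α * κ * s ^ (-α) := by
    have h1 : 0 < s ^ α := Real.rpow_pos_of_pos hs α
    have h := one_div_le_one_div_of_le (by positivity) (hlow s hs)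
    rw [Real.rpow_neg (le_of_lt hs)]
    refine h.trans (le_of_eq ?_)
    rw [one_div_div, div_eq_mul_inv]
  have hp1 : s ^ (1 - α) = s * s ^ (-α) := by
    rw [sub_eq_add_neg, Real.rpow_add hs0, Real.rpow_one]
  have hp2 : s ^ (1 - 2 * α) = s * (s ^ (-α) * s ^ (-α)) := by
    rw [show 1 - 2 * α = 1 + (-α + -α) by ring, Real.rpow_add hs0, Real.rpow_add hs0, Real.rpow_one]
  have hD2 : deriv (deriv (xiEta f η)) s * F s * s ^ 2 =
      -1 / s - deriv F s / F s + 2 * η * E s * (s * deriv F s / F s)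
        + 2 * η * (1 / (s ^ 2 * F s)) - 4 * η ^ 2 * s * (E s * (1 / (s ^ 2 * F s))) := by
    have hev : deriv (xiEta f η) =ᶠ[nhds s]
        fun s => -E s - 2 * η * s * E s / (s ^ 2 * F s) + 1 / (s ^ 2 * F s) := by
      filter_upwards [Ioi_mem_nhds hs0] with t ht using hD t ht
    rw [hev.deriv_eq]
    have hgd : HasDerivAt (fun t => t ^ 2 * F t) (2 * s * F s + s ^ 2 * deriv F s) s := by
      refine (((hasDerivAt_id s).pow 2).mul (hd s hs).hasDerivAt).congr_deriv ?_
      simp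
    have hn : HasDerivAt (fun t => 2 * η * t * E t)
        (2 * η * E s + 2 * η * s * (2 * η * E s / (s ^ 2 * F s) - 1 / (s ^ 3 * F s))) s := by
      refine (((hasDerivAt_id s).const_mul (2 * η)).mul hE2).congr_deriv ?_
      simp
    have hder := ((hE2.neg.sub (hn.div hgd hg.ne')).add
      ((hasDerivAt_const s (1:ℝ)).div hgd hg.ne')).deriv
    refine (congrArg (fun x => x * F s * s ^ 2) hder).trans ?_
    field_simp
    ring
  have hEi : E s * (1 / (s ^ 2 * F s)) ≤ κ * s ^ (-α) * (α * κ * s ^ (-α)) :=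
    mul_le_mul hE1 hinv (by positivity) (by positivity)
  have hEi0 : 0 ≤ E s * (1 / (s ^ 2 * F s)) := by positivity
  have hi0 : 0 ≤ 1 / (s ^ 2 * F s) := by positivity
  refine ⟨?_, ?_, ?_⟩
  · rw [hxi, hp1]
    simp only
    rw [abs_mul, abs_neg, abs_of_pos hs0, abs_of_nonneg hE0]
    nlinarith [mul_le_mul_of_nonneg_left hE1 hs0.le]
  · rw [hD s hs, hp2]
    have e : 2 * η * s * E s / (s ^ 2 * F s) = 2 * η * s * (E s * (1 / (s ^ 2 * F s))) := by ring
    rw [e]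
    have h1 := mul_le_mul_of_nonneg_left hEi (by positivity : 0 ≤ 2 * η * s)
    have h2 := mul_nonneg (by positivity : 0 ≤ 2 * η * s) hEi0
    have h3 : 0 ≤ α * κ * s ^ (-α) := by positivity
    have h4 : 0 ≤ κ * s ^ (-α) := by positivity
    rw [abs_le]
    constructor <;> nlinarith
  · rw [hD2, hp2, Real.rpow_neg_one]
    have hT := hthree s hs
    set T := s * deriv F s / F s with hTdef
    have e : deriv F s / F s = T * s⁻¹ := by rw [hTdef]; field_simp
    rw [e]
    have hsi : 0 < s⁻¹ := by positivity
    have b1 : |T * s⁻¹| ≤ κ * s⁻¹ := by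
      rw [abs_mul, abs_of_pos hsi]
      exact mul_le_mul_of_nonneg_right hT hsi.le
    have b2 : |2 * η * E s * T| ≤ 2 * η * (κ * s ^ (-α) * κ) := by
      rw [abs_mul, abs_of_nonneg (by positivity), mul_assoc]
      exact mul_le_mul_of_nonneg_left (mul_le_mul hE1 hT (abs_nonneg _) (by positivity))
        (by positivity)
    have b3 := mul_le_mul_of_nonneg_left hinv (by positivity : 0 ≤ 2 * η)
    have b30 := mul_nonneg (by positivity : 0 ≤ 2 * η) hi0
    have b4 := mul_le_mul_of_nonneg_left hEi (by positivity : 0 ≤ 4 * η ^ 2 * s)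
    have b40 := mul_nonneg (by positivity : 0 ≤ 4 * η ^ 2 * s) hEi0
    have h0 : 0 ≤ 2 * η * κ * 2 * s ^ (-α) := by positivity
    have h5 : 0 ≤ 2 * η * (α * κ * s ^ (-α)) := by positivity
    have e1 : -1 / s = - s⁻¹ := by ring
    rw [e1]
    rw [abs_le] at b1 b2 ⊢
    constructor <;> linarith
end

section
/- Let Ω = (0,L), T > 0, p > 0 and M > 0. Let σ : [0,T]×[0,L] → [0,∞) be measurable with σ(t,·) ∈ C¹([0,L]) for every t ∈ [0,T] and ∫_Ω σ(t,x) dx ≤ M for every t ∈ [0,T]. Then there exists a constant K > 0, depending only on p, L, T and M, such that ∫_0^T ∫_Ω σ(t,x)^{p+2} dx dt ≤ K (∫_0^T ∫_Ω |∂_x (σ(t,x)^{p/2})|² dx dt + 1). -/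
open MeasureTheory Set

lemma sti_level (f : ℝ → ℝ) (L m x y : ℝ)
    (hf : ContinuousOn f (Ioo 0 L)) (hx : x ∈ Ioo 0 L) (hy : y ∈ Ioo 0 L)
    (hfy : f y ≤ m) (hfx : m < f x) :
    ∃ z ∈ Ioo 0 L, f z = m ∧ ∀ s ∈ uIcc z x, m ≤ f s := by
  have hsub : ∀ a ∈ Ioo 0 L, uIcc a x ⊆ Ioo 0 L := fun a ha =>
    (ordConnected_Ioo (a := (0:ℝ)) (b := L)).uIcc_subset ha hx
  have hcont : ContinuousOn f (uIcc y x) := hf.mono (hsub y hy)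
  have hcomp : IsCompact (uIcc y x ∩ f ⁻¹' {m}) :=
    isCompact_uIcc.of_isClosed_subset
      (hcont.preimage_isClosed_of_isClosed isCompact_uIcc.isClosed isClosed_singleton)
      inter_subset_left
  have hne : (uIcc y x ∩ f ⁻¹' {m}).Nonempty := by
    have := intermediate_value_uIcc hcont (show m ∈ uIcc (f y) (f x) from
      Icc_subset_uIcc ⟨hfy, hfx.le⟩)
    obtain ⟨s, hs, h⟩ := this
    exact ⟨s, hs, h⟩
  obtain ⟨z, ⟨hz1, hz2⟩, hmin⟩ := hcomp.exists_isMinOn hne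
    (f := fun s => |s - x|) (by fun_prop)
  have hzI := hsub y hy hz1
  refine ⟨z, hzI, hz2, fun s hs => ?_⟩
  by_contra! hlt
  have hsI := hsub z hzI hs
  obtain ⟨r, hr, hr2⟩ := intermediate_value_uIcc (hf.mono (hsub s hsI))
    (show m ∈ uIcc (f s) (f x) from Icc_subset_uIcc ⟨hlt.le, hfx.le⟩)
  have hzyx : uIcc z x ⊆ uIcc y x := uIcc_subset_uIcc hz1 right_mem_uIcc
  have hszx : uIcc s x ⊆ uIcc z x := uIcc_subset_uIcc hs right_mem_uIcc
  have h1 : |z - x| ≤ |r - x| := hmin ⟨hzyx (hszx hr), hr2⟩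
  have hne : r ≠ s := by rintro rfl; exact hlt.ne hr2
  rcases le_total z x with hzx | hzx
  · rw [uIcc_of_le hzx] at hs
    rw [uIcc_of_le hs.2] at hr
    rw [abs_of_nonpos (by linarith), abs_of_nonpos (by linarith [hr.2])] at h1
    exact hne (le_antisymm (by linarith [hs.1]) hr.1)
  · rw [uIcc_of_ge hzx] at hs
    rw [uIcc_of_ge hs.1] at hr
    rw [abs_of_nonneg (by linarith), abs_of_nonneg (by linarith [hr.1])] at h1
    exact hne (le_antisymm hr.2 (by linarith [hs.2]))

lemma sti_sup (L p M : ℝ) (hL : 0 < L) (hp : 0 < p) (hM : 0 < M) (f : ℝ → ℝ)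
    (h0 : ∀ x ∈ Icc 0 L, 0 ≤ f x) (hc : ContDiffOn ℝ 1 f (Icc 0 L))
    (hI : (∫ x in Ioo 0 L, f x) ≤ M) (x : ℝ) (hx : x ∈ Ioo 0 L) :
    ENNReal.ofReal (f x ^ (p + 1)) ≤
      ENNReal.ofReal (2 * (M / L) ^ (p + 1) + 2 * ((p + 1) / p) ^ 2 * M) +
      ENNReal.ofReal (2 * ((p + 1) / p) ^ 2 * M) *
        ∫⁻ x in Ioo 0 L, ENNReal.ofReal ((deriv (fun y => f y ^ (p / 2)) x) ^ 2) := by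
  have hm : 0 < M / L := by positivity
  set m := M / L with hmdef
  set c := (p + 1) / p with hcdef
  have hcpos : 0 < c := by positivity
  have hfint : IntegrableOn f (Ioo 0 L) :=
    (hc.continuousOn.integrableOn_compact isCompact_Icc).mono_set Ioo_subset_Icc_self
  have hc' : ContDiffOn ℝ 1 f (Ioo 0 L) := hc.mono Ioo_subset_Icc_self
  by_cases hfx : f x ≤ m
  · refine le_trans (ENNReal.ofReal_le_ofReal ?_) le_self_add
    have h1 : f x ^ (p + 1) ≤ m ^ (p + 1) :=
      Real.rpow_le_rpow (h0 x (Ioo_subset_Icc_self hx)) hfx (by linarith)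
    have : 0 < m ^ (p + 1) := by positivity
    have : 0 < c ^ 2 * M := by positivity
    nlinarith
  push Not at hfx
  obtain ⟨y, hy, hfy⟩ : ∃ y ∈ Ioo 0 L, f y ≤ m := by
    have hv : volume (Ioo 0 L) = ENNReal.ofReal L := by simp
    obtain ⟨y, hy, h⟩ := exists_le_setAverage (μ := volume) (s := Ioo 0 L) (f := f)
      (by rw [hv]; simpa using hL) (by simp) hfint
    refine ⟨y, hy, h.trans ?_⟩
    rw [setAverage_eq, smul_eq_mul, measureReal_def, hv, ENNReal.toReal_ofReal hL.le, hmdef,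
      div_eq_inv_mul]
    gcongr
  obtain ⟨z, hz, hfz, hge⟩ := sti_level f L m x y hc'.continuousOn hx hy hfy hfx
  have hsub : uIcc z x ⊆ Ioo 0 L := (ordConnected_Ioo).uIcc_subset hz hx
  have hsubι : Set.uIoc z x ⊆ Ioo 0 L := uIoc_subset_uIcc.trans hsub
  have hpos : ∀ s ∈ uIcc z x, 0 < f s := fun s hs => hm.trans_le (hge s hs)
  have hfc : ContinuousOn f (uIcc z x) := hc'.continuousOn.mono hsub
  have hdc : ContinuousOn (deriv f) (uIcc z x) :=
    (hc'.continuousOn_deriv_of_isOpen isOpen_Ioo le_rfl).mono hsub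
  have hd : ∀ s ∈ uIcc z x, HasDerivAt f (deriv f s) s := fun s hs =>
    ((hc'.differentiableOn one_ne_zero).differentiableAt
      (isOpen_Ioo.mem_nhds (hsub hs))).hasDerivAt
  set U : ℝ → ℝ := fun s => deriv f s * (p / 2) * f s ^ (p / 2 - 1) with hU
  set W : ℝ → ℝ := fun s => deriv f s * ((p + 1) / 2) * f s ^ ((p + 1) / 2 - 1) with hW
  have hUd : ∀ s ∈ uIcc z x, deriv (fun y => f y ^ (p / 2)) s = U s := fun s hs =>
    ((hd s hs).rpow_const (Or.inl (hpos s hs).ne')).deriv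
  have hWd : ∀ s ∈ uIcc z x, HasDerivAt (fun y => f y ^ ((p + 1) / 2)) (W s) s := fun s hs =>
    (hd s hs).rpow_const (Or.inl (hpos s hs).ne')
  have hUc : ContinuousOn U (uIcc z x) :=
    (hdc.mul continuousOn_const).mul
      (hfc.rpow_const fun s hs => Or.inl (hpos s hs).ne')
  have hWc : ContinuousOn W (uIcc z x) :=
    (hdc.mul continuousOn_const).mul
      (hfc.rpow_const fun s hs => Or.inl (hpos s hs).ne')
  have hftc := intervalIntegral.integral_eq_sub_of_hasDerivAt hWd hWc.intervalIntegrable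
  have iU : IntegrableOn (fun s => U s ^ 2) (Set.uIoc z x) :=
    ((hUc.pow 2).integrableOn_compact isCompact_uIcc).mono_set uIoc_subset_uIcc
  have iF : IntegrableOn f (Set.uIoc z x) := hfint.mono_set hsubι
  have iW : IntegrableOn W (Set.uIoc z x) :=
    (hWc.integrableOn_compact isCompact_uIcc).mono_set uIoc_subset_uIcc
  set J := ∫ s in Set.uIoc z x, U s ^ 2 with hJ
  have hJ0 : 0 ≤ J := integral_nonneg fun s => sq_nonneg _
  have hF : ∫ s in Set.uIoc z x, f s ≤ M :=
    (setIntegral_mono_set hfint ((ae_restrict_iff' measurableSet_Ioo).2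
      (Filter.Eventually.of_forall fun s hs => h0 s (Ioo_subset_Icc_self hs)))
      (LE.le.eventuallyLE hsubι)).trans hI
  -- pointwise Young
  have hyoung : ∀ l : ℝ, 0 < l → ∀ s ∈ uIcc z x, |W s| ≤ c / 2 * (l * f s + U s ^ 2 / l) := by
    intro l hl s hs
    have hfs := hpos s hs
    have e : W s = c * (f s ^ (1 / 2 : ℝ) * U s) := by
      have : f s ^ ((p + 1) / 2 - 1) = f s ^ (1 / 2 : ℝ) * f s ^ (p / 2 - 1) := by
        rw [← Real.rpow_add hfs]; congr 1; ring
      simp only [hW, hU, hcdef, this]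
      field_simp
    have e2 : (f s ^ (1 / 2 : ℝ)) ^ 2 = f s := by
      rw [← Real.sqrt_eq_rpow, Real.sq_sqrt hfs.le]
    rw [e, abs_mul, abs_of_pos hcpos, abs_mul]
    set a := f s ^ (1 / 2 : ℝ)
    rw [← e2, ← sq_abs a, ← sq_abs (U s)]
    have h3 : 2 * (|a| * |U s|) ≤ l * |a| ^ 2 + |U s| ^ 2 / l := by
      have : l * |a| ^ 2 + |U s| ^ 2 / l - 2 * (|a| * |U s|) = (l * |a| - |U s|) ^ 2 / l := by
        field_simp; ring
      have : 0 ≤ (l * |a| - |U s|) ^ 2 / l := by positivity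
      linarith
    nlinarith
  have hbound : ∀ l : ℝ, 0 < l →
      f x ^ ((p + 1) / 2) - m ^ ((p + 1) / 2) ≤ c / 2 * (l * M + J / l) := by
    intro l hl
    have h1 : f x ^ ((p + 1) / 2) - m ^ ((p + 1) / 2) ≤ ∫ s in Set.uIoc z x, |W s| := by
      rw [← hfz, ← hftc]
      have h9 := intervalIntegral.norm_integral_le_integral_norm_uIoc (f := W) (a := z) (b := x)
        (μ := volume)
      simp only [Real.norm_eq_abs] at h9
      exact (le_abs_self _).trans h9
    refine h1.trans ?_
    have h2 : ∫ s in Set.uIoc z x, |W s| ≤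
        ∫ s in Set.uIoc z x, c / 2 * (l * f s + U s ^ 2 / l) :=
      setIntegral_mono_on iW.abs (((iF.const_mul l).add (iU.div_const l)).const_mul _)
        measurableSet_uIoc fun s hs => hyoung l hl s (uIoc_subset_uIcc hs)
    refine h2.trans ?_
    rw [integral_const_mul, integral_add (iF.const_mul l) (iU.div_const l), integral_const_mul,
      integral_div]
    gcongr
  set R := Real.sqrt (M * (J + 1)) with hR
  have hRp : 0 < R := Real.sqrt_pos.2 (by positivity)
  have hR2 : R ^ 2 = M * (J + 1) := Real.sq_sqrt (by positivity)
  have hmain : f x ^ ((p + 1) / 2) - m ^ ((p + 1) / 2) ≤ c * R := by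
    refine (hbound (R / M) (by positivity)).trans ?_
    have e1 : R / M * M = R := by field_simp
    have e2 : J / (R / M) ≤ R := by
      rw [div_le_iff₀ (by positivity)]
      have : R * (R / M) = J + 1 := by
        rw [← mul_div_assoc, ← sq, hR2]; field_simp
      linarith
    rw [e1]
    nlinarith
  have hsq : ∀ v : ℝ, 0 ≤ v → v ^ (p + 1) = (v ^ ((p + 1) / 2)) ^ 2 := by
    intro v hv
    rw [← Real.rpow_natCast, ← Real.rpow_mul hv]; congr 1; push_cast; ring
  have hreal : f x ^ (p + 1) ≤ (2 * m ^ (p + 1) + 2 * c ^ 2 * M) + 2 * c ^ 2 * M * J := by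
    rw [hsq _ (hm.le.trans hfx.le), hsq _ hm.le]
    set a := f x ^ ((p + 1) / 2)
    set b := m ^ ((p + 1) / 2)
    have ha : 0 ≤ a := Real.rpow_nonneg (hm.le.trans hfx.le) _
    have h5 : a ^ 2 ≤ (b + c * R) ^ 2 := by
      apply pow_le_pow_left₀ ha; linarith
    have h6 : (c * R) ^ 2 = c ^ 2 * M * (J + 1) := by rw [mul_pow, hR2]; ring
    nlinarith [sq_nonneg (b - c * R)]
  have hJD : ENNReal.ofReal J ≤
      ∫⁻ x in Ioo 0 L, ENNReal.ofReal ((deriv (fun y => f y ^ (p / 2)) x) ^ 2) := by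
    rw [hJ, ofReal_integral_eq_lintegral_ofReal iU (Filter.Eventually.of_forall fun s => sq_nonneg _)]
    refine le_trans (le_of_eq ?_) (lintegral_mono_set hsubι)
    refine setLIntegral_congr_fun measurableSet_uIoc fun s hs => ?_
    simp only [hUd s (uIoc_subset_uIcc hs)]
  refine (ENNReal.ofReal_le_ofReal hreal).trans ?_
  rw [ENNReal.ofReal_add (by positivity) (by positivity), ENNReal.ofReal_mul (p := 2 * c ^ 2 * M) (by positivity)]
  gcongr

/-- a Gagliardo–Nirenberg-type interpolation inequality. For a
nonnegative density `σ` on `[0,T]×[0,L]` with `σ(t,·) ∈ C¹([0,L])` and mass bounded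
by `M` for each `t`, the `L^{p+2}` norm in space-time is controlled by the
`L²` norm of `∂_x(σ^{p/2})`, with a constant depending only on `p, L, T, M`. -/
theorem space_time_interpolation (L T p M : ℝ)
    (hL : 0 < L) (hT : 0 < T) (hp : 0 < p) (hM : 0 < M) :
    ∃ K : ℝ, 0 < K ∧
      ∀ σ : ℝ → ℝ → ℝ,
        Measurable (fun q : ℝ × ℝ => σ q.1 q.2) →
        (∀ t ∈ Icc 0 T, ∀ x ∈ Icc 0 L, 0 ≤ σ t x) →
        (∀ t ∈ Icc 0 T, ContDiffOn ℝ 1 (σ t) (Icc 0 L)) →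
        (∀ t ∈ Icc 0 T, (∫ x in Ioo 0 L, σ t x) ≤ M) →
        (∫⁻ t in Ioc 0 T, ∫⁻ x in Ioo 0 L, ENNReal.ofReal (σ t x ^ (p + 2))) ≤
          ENNReal.ofReal K *
            ((∫⁻ t in Ioc 0 T, ∫⁻ x in Ioo 0 L,
                ENNReal.ofReal ((deriv (fun y => σ t y ^ (p / 2)) x) ^ 2)) + 1) := by
  set A := 2 * (M / L) ^ (p + 1) + 2 * ((p + 1) / p) ^ 2 * M with hA
  set B := 2 * ((p + 1) / p) ^ 2 * M with hB
  have hBp : 0 < B := by positivity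
  have hAp : 0 < A := by positivity
  refine ⟨A * M * T + B * M, by positivity, fun σ hmeas h0 hc hI => ?_⟩
  set D : ℝ → ENNReal := fun t => ∫⁻ x in Ioo 0 L,
    ENNReal.ofReal ((deriv (fun y => σ t y ^ (p / 2)) x) ^ 2) with hD
  have key : ∀ t ∈ Ioc 0 T, (∫⁻ x in Ioo 0 L, ENNReal.ofReal (σ t x ^ (p + 2))) ≤
      ENNReal.ofReal (A * M) + ENNReal.ofReal (B * M) * D t := by
    intro t ht
    have ht' := Ioc_subset_Icc_self ht
    have hmt : Measurable (σ t) := hmeas.comp measurable_prodMk_left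
    have hfint : IntegrableOn (σ t) (Ioo 0 L) :=
      ((hc t ht').continuousOn.integrableOn_compact isCompact_Icc).mono_set Ioo_subset_Icc_self
    calc (∫⁻ x in Ioo 0 L, ENNReal.ofReal (σ t x ^ (p + 2)))
        ≤ ∫⁻ x in Ioo 0 L, (ENNReal.ofReal A + ENNReal.ofReal B * D t) *
            ENNReal.ofReal (σ t x) := by
          refine setLIntegral_mono' measurableSet_Ioo fun x hx => ?_
          have hx0 := h0 t ht' x (Ioo_subset_Icc_self hx)
          have : σ t x ^ (p + 2) = σ t x ^ (p + 1) * σ t x := by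
            rw [show p + 2 = (p + 1) + 1 by ring, Real.rpow_add_one' hx0 (by linarith)]
          rw [this, ENNReal.ofReal_mul (Real.rpow_nonneg hx0 _)]
          gcongr
          exact sti_sup L p M hL hp hM (σ t) (h0 t ht') (hc t ht') (hI t ht') x hx
      _ = (ENNReal.ofReal A + ENNReal.ofReal B * D t) * ENNReal.ofReal (∫ x in Ioo 0 L, σ t x) := by
          rw [lintegral_const_mul _ hmt.ennreal_ofReal,
            ofReal_integral_eq_lintegral_ofReal hfint ((ae_restrict_iff' measurableSet_Ioo).2
              (Filter.Eventually.of_forall fun s hs => h0 t ht' s (Ioo_subset_Icc_self hs)))]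
      _ ≤ (ENNReal.ofReal A + ENNReal.ofReal B * D t) * ENNReal.ofReal M := by
          gcongr
          exact hI t ht'
      _ = _ := by
          rw [ENNReal.ofReal_mul hAp.le, ENNReal.ofReal_mul hBp.le]; ring
  calc _ ≤ ∫⁻ t in Ioc 0 T, (ENNReal.ofReal (A * M) + ENNReal.ofReal (B * M) * D t) :=
        setLIntegral_mono' measurableSet_Ioc key
    _ = ENNReal.ofReal (A * M * T) + ENNReal.ofReal (B * M) * ∫⁻ t in Ioc 0 T, D t := by
        rw [lintegral_add_left measurable_const, lintegral_const_mul' _ _ ENNReal.ofReal_ne_top,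
          setLIntegral_const, Real.volume_Ioc, sub_zero, ← ENNReal.ofReal_mul (by positivity)]
    _ ≤ _ := by
        rw [mul_add, mul_one, add_comm]
        gcongr
        · have : 0 < A * M * T := by positivity
          linarith
        · have : 0 < B * M := by positivity
          linarith
end

section
/- Let Ω = (0,L), T > 0, η > 0. Let φ ∈ C([0,T]; C³([0,L])) ∩ C¹([0,T]; C¹([0,L])) and a, b ∈ C([0,T]; C¹([0,L])) satisfy pointwise ∂_t φ = η ∂_{xx} φ + a ∂_x φ + b on (0,T)×Ω, with ∂_x φ(t,x) = 0 for all t ∈ (0,T) and x ∈ {0,L}. Suppose there exists a nonnegative 𝓑 ∈ L¹([0,T]) such that ∫_Ω |∂_x b(t,x)| dx ≤ 𝓑(t)(1 + ∫_Ω |∂_x φ(t,x)| dx) for almost every t ∈ [0,T]. Then for every t ∈ [0,T]: ∫_Ω |∂_x φ(t,x)| dx + 1 ≤ (∫_Ω |∂_x φ(0,x)| dx + 1) · exp(∫_0^t 𝓑(s) ds). Moreover, if r : [0,T]×[0,L] → ℝ with r(t,·) ∈ C¹([0,L]) for all t and there are Λ₁, Λ₂ > 0 with ∫_Ω |∂_x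 φ(t,x)| dx ≤ Λ₁(∫_Ω |∂_x r(t,x)| dx + 1) and ∫_Ω |∂_x r(t,x)| dx ≤ Λ₂(∫_Ω |∂_x φ(t,x)| dx + 1) for all t ∈ [0,T], then sup_{t∈[0,T]} ∫_Ω |∂_x r(t,x)| dx ≤ Λ₂ (1 + Λ₁(1 + ∫_Ω |∂_x r(0,x)| dx)) · exp(∫_0^T 𝓑(s) ds). -/
open MeasureTheory Set

/-- Spatial partial derivative. -/
noncomputable def pdx (u : ℝ → ℝ → ℝ) : ℝ → ℝ → ℝ := fun t x => deriv (u t) x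

/-- Time partial derivative. -/
noncomputable def pdt (u : ℝ → ℝ → ℝ) : ℝ → ℝ → ℝ := fun t x => deriv (fun τ => u τ x) t

/-- Joint continuity on a time-space rectangle. -/
def JointCont (S X : Set ℝ) (u : ℝ → ℝ → ℝ) : Prop :=
  ContinuousOn (fun p : ℝ × ℝ => u p.1 p.2) (S ×ˢ X)

/-- `u ∈ C(S; C²([0,L]))`. -/
def CtC2 (S : Set ℝ) (L : ℝ) (u : ℝ → ℝ → ℝ) : Prop :=
  JointCont S (Icc 0 L) u ∧ JointCont S (Icc 0 L) (pdx u) ∧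
    JointCont S (Icc 0 L) (pdx (pdx u)) ∧
    ∀ t ∈ S, ∀ x ∈ Icc 0 L, DifferentiableAt ℝ (u t) x ∧ DifferentiableAt ℝ (pdx u t) x

/-- `u ∈ C(S; C³([0,L]))`. -/
def CtC3 (S : Set ℝ) (L : ℝ) (u : ℝ → ℝ → ℝ) : Prop :=
  CtC2 S L u ∧ JointCont S (Icc 0 L) (pdx (pdx (pdx u))) ∧
    ∀ t ∈ S, ∀ x ∈ Icc 0 L, DifferentiableAt ℝ (pdx (pdx u) t) x

/-- `u ∈ C¹(S; C([0,L]))`. -/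
def C1tC (S : Set ℝ) (L : ℝ) (u : ℝ → ℝ → ℝ) : Prop :=
  JointCont S (Icc 0 L) (pdt u) ∧
    ∀ t ∈ S, ∀ x ∈ Icc 0 L, DifferentiableAt ℝ (fun τ => u τ x) t

/-- `u ∈ C¹(S; C¹([0,L]))`. -/
def C1tC1 (S : Set ℝ) (L : ℝ) (u : ℝ → ℝ → ℝ) : Prop :=
  C1tC S L u ∧ JointCont S (Icc 0 L) (pdt (pdx u)) ∧
    ∀ t ∈ S, ∀ x ∈ Icc 0 L, DifferentiableAt ℝ (fun τ => pdx u τ x) t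

/-- `u ∈ C(S; C¹([0,L]))`. -/
def CtC1 (S : Set ℝ) (L : ℝ) (u : ℝ → ℝ → ℝ) : Prop :=
  JointCont S (Icc 0 L) u ∧ JointCont S (Icc 0 L) (pdx u) ∧
    ∀ t ∈ S, ∀ x ∈ Icc 0 L, DifferentiableAt ℝ (u t) x

lemma contParam {T L : ℝ} (hT : 0 ≤ T) (hL : 0 ≤ L) {f : ℝ → ℝ → ℝ}
    (hf : JointCont (Icc 0 T) (Icc 0 L) f) :
    ContinuousOn (fun t => ∫ x in (0:ℝ)..L, f t x) (Icc 0 T) := by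
  have h1 : Continuous (Function.uncurry fun t x : ℝ => f (projIcc 0 T hT t) (projIcc 0 L hL x)) := by
    have : Continuous (fun p : ℝ × ℝ => ((projIcc 0 T hT p.1 : ℝ), (projIcc 0 L hL p.2 : ℝ))) := by
      fun_prop
    exact hf.comp_continuous this (fun p => ⟨(projIcc 0 T hT p.1).2, (projIcc 0 L hL p.2).2⟩)
  have h2 := intervalIntegral.continuous_parametric_intervalIntegral_of_continuous' (μ := volume) h1 0 L
  refine h2.continuousOn.congr fun t ht => ?_
  refine intervalIntegral.integral_congr fun x hx => ?_
  rw [uIcc_of_le hL] at hx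
  simp only [projIcc_of_mem hT ht, projIcc_of_mem hL hx]

lemma slice_cont {S X : Set ℝ} {f : ℝ → ℝ → ℝ} (hf : JointCont S X f) {t : ℝ} (ht : t ∈ S) :
    ContinuousOn (f t) X :=
  ContinuousOn.comp (g := fun p : ℝ × ℝ => f p.1 p.2) hf
    (f := fun x => (t, x)) (by fun_prop) (fun x hx => ⟨ht, hx⟩)

lemma derivParam {T L : ℝ} {c d : ℝ} (hcd : c ≤ d) (hc : 0 ≤ c) (hd : d ≤ L)
    {f f' : ℝ → ℝ → ℝ}
    (hf : JointCont (Icc 0 T) (Icc 0 L) f) (hf' : JointCont (Icc 0 T) (Icc 0 L) f')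
    (hder : ∀ t ∈ Ioo 0 T, ∀ x ∈ Icc 0 L, HasDerivAt (fun τ => f τ x) (f' t x) t)
    {t : ℝ} (ht : t ∈ Ioo 0 T) :
    HasDerivAt (fun t => ∫ x in c..d, f t x) (∫ x in c..d, f' t x) t := by
  obtain ⟨M, hM⟩ := (isCompact_Icc.prod isCompact_Icc).exists_bound_of_continuousOn hf'
  have hsub : uIcc c d ⊆ Icc 0 L := by
    rw [uIcc_of_le hcd]; exact Icc_subset_Icc hc hd
  have hsub' : uIoc c d ⊆ Icc 0 L := uIoc_subset_uIcc.trans hsub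
  have hint : ∀ {g : ℝ → ℝ → ℝ}, JointCont (Icc 0 T) (Icc 0 L) g → ∀ s ∈ Ioo 0 T,
      IntervalIntegrable (g s) volume c d := fun hg s hs =>
    ((slice_cont hg (Ioo_subset_Icc_self hs)).mono hsub).intervalIntegrable
  refine (intervalIntegral.hasDerivAt_integral_of_dominated_loc_of_deriv_le
    (s := Ioo 0 T) (bound := fun _ => M) (Ioo_mem_nhds ht.1 ht.2) ?_ (hint hf t ht) ?_ ?_ ?_ ?_).2
  · filter_upwards [Ioo_mem_nhds ht.1 ht.2] with s hs
    exact (intervalIntegrable_iff.1 (hint hf s hs)).aestronglyMeasurable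
  · exact (intervalIntegrable_iff.1 (hint hf' t ht)).aestronglyMeasurable
  · refine Filter.Eventually.of_forall fun x hx s hs => ?_
    exact hM (s, x) ⟨Ioo_subset_Icc_self hs, hsub' hx⟩
  · exact intervalIntegrable_const
  · exact Filter.Eventually.of_forall fun x hx s hs => hder s hs x (hsub' hx)

/-- smoothed absolute value -/
noncomputable def JJ (ε s : ℝ) : ℝ := Real.sqrt (s ^ 2 + ε ^ 2)

lemma JJ_pos {ε : ℝ} (hε : 0 < ε) (s : ℝ) : 0 < JJ ε s := Real.sqrt_pos.2 (by positivity)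
lemma JJ_sq (ε s : ℝ) : JJ ε s ^ 2 = s ^ 2 + ε ^ 2 := Real.sq_sqrt (by positivity)
lemma JJ_cont (ε : ℝ) : Continuous (JJ ε) := by unfold JJ; fun_prop

lemma JJ_deriv {ε : ℝ} (hε : 0 < ε) (s : ℝ) : HasDerivAt (JJ ε) (s / JJ ε s) s := by
  have h1 : HasDerivAt (fun s : ℝ => s ^ 2 + ε ^ 2) (2 * s) s := by
    simpa using (hasDerivAt_pow 2 s).add_const (ε ^ 2)
  have := h1.sqrt (by positivity)
  refine this.congr_deriv ?_
  unfold JJ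
  exact mul_div_mul_left _ _ (by norm_num)

lemma JJ_deriv2 {ε : ℝ} (hε : 0 < ε) (s : ℝ) :
    HasDerivAt (fun s => s / JJ ε s) (ε ^ 2 / JJ ε s ^ 3) s := by
  have hp := JJ_pos hε s
  have := (hasDerivAt_id s).div (JJ_deriv hε s) hp.ne'
  refine this.congr_deriv ?_
  have h2 := JJ_sq ε s
  simp only [id]
  field_simp
  linear_combination h2

lemma JJ_abs_le {ε : ℝ} (s : ℝ) : |s| ≤ JJ ε s := by
  unfold JJ; apply Real.le_sqrt_of_sq_le; rw [sq_abs]; nlinarith [sq_nonneg ε]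

lemma JJ_le {ε : ℝ} (hε : 0 < ε) (s : ℝ) : JJ ε s ≤ |s| + ε := by
  unfold JJ; apply Real.sqrt_le_iff.2 ⟨by positivity, ?_⟩
  nlinarith [sq_abs s, mul_nonneg (abs_nonneg s) hε.le]

lemma JJ_d_abs {ε : ℝ} (hε : 0 < ε) (s : ℝ) : |s / JJ ε s| ≤ 1 := by
  rw [abs_div, abs_of_pos (JJ_pos hε s)]
  exact (div_le_one (JJ_pos hε s)).2 (JJ_abs_le s)

lemma JJ_d2_sq {ε : ℝ} (hε : 0 < ε) (s : ℝ) : ε ^ 2 / JJ ε s ^ 3 * s ^ 2 ≤ ε := by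
  have hp := JJ_pos hε s
  have h2 := JJ_sq ε s
  have h3 : ε ≤ JJ ε s := by
    unfold JJ; apply Real.le_sqrt_of_sq_le; nlinarith [sq_nonneg s]
  rw [div_mul_eq_mul_div, div_le_iff₀ (by positivity)]
  have : JJ ε s ^ 3 = JJ ε s * (s ^ 2 + ε ^ 2) := by rw [← h2]; ring
  rw [this]
  have h4 : ε * s ^ 2 ≤ JJ ε s * (s ^ 2 + ε ^ 2) := by
    apply mul_le_mul h3 _ (by positivity) hp.le; nlinarith [sq_nonneg ε]
  nlinarith

lemma young {η j p v a M ε : ℝ} (hη : 0 < η) (hj : 0 ≤ j) (hjv : j * v ^ 2 ≤ ε)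
    (hM : |a| ≤ M) : -(j * p * (η * p + a * v)) ≤ ε * (M ^ 2 / (4 * η)) := by
  have ha : a ^ 2 ≤ M ^ 2 := sq_le_sq' (abs_le.1 hM).1 (abs_le.1 hM).2
  have h1 : -(j * p * (η * p + a * v)) ≤ j * v ^ 2 * (a ^ 2 / (4 * η)) := by
    have : j * v ^ 2 * (a ^ 2 / (4 * η)) + (j * p * (η * p + a * v))
        = j * (2 * η * p + a * v) ^ 2 / (4 * η) := by field_simp; ring
    have : 0 ≤ j * (2 * η * p + a * v) ^ 2 / (4 * η) := by positivity
    linarith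
  refine h1.trans ?_
  have h2 : 0 ≤ j * v ^ 2 := by positivity
  have h3 : 0 ≤ ε := h2.trans hjv
  gcongr

/-- Gronwall -/
lemma gron {T : ℝ} {F β B : ℝ → ℝ} (hβ : ContinuousOn β (Icc 0 T))
    (hF0 : 0 < F 0) (hβ0 : ∀ t ∈ Icc 0 T, 0 ≤ β t)
    (hF : ∀ t ∈ Icc 0 T, F t ≤ F 0 + ∫ s in (0:ℝ)..t, β s)
    (hB : IntegrableOn B (Icc 0 T)) (hB0 : ∀ t, 0 ≤ B t)
    (hae : ∀ᵐ t ∂(volume.restrict (Icc 0 T)), β t ≤ B t * F t) :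
    ∀ t ∈ Icc 0 T, F t ≤ F 0 * Real.exp (∫ s in (0:ℝ)..t, B s) := by
  intro t ht
  have hsub : Icc 0 t ⊆ Icc 0 T := Icc_subset_Icc_right ht.2
  set G : ℝ → ℝ := fun t => F 0 + ∫ s in (0:ℝ)..t, β s with hG
  have hβi : ∀ s ∈ Icc 0 t, IntervalIntegrable β volume 0 s := fun s hs =>
    (hβ.mono (by rw [uIcc_of_le hs.1]; exact Icc_subset_Icc_right (hs.2.trans ht.2))).intervalIntegrable
  have hGpos : ∀ s ∈ Icc 0 t, 0 < G s := by
    intro s hs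
    have : 0 ≤ ∫ s in (0:ℝ)..s, β s := intervalIntegral.integral_nonneg hs.1
      (fun u hu => hβ0 u ⟨hu.1, hu.2.trans (hs.2.trans ht.2)⟩)
    simp only [hG]; linarith
  have hGc : ContinuousOn G (Icc 0 t) := by
    have := intervalIntegral.continuousOn_primitive_interval
      (f := β) (μ := volume) (a := 0) (b := t)
      (by rw [uIcc_of_le ht.1]; exact (hβ.mono hsub).integrableOn_Icc)
    rw [uIcc_of_le ht.1] at this
    exact continuousOn_const.add this
  have hGd : ∀ s ∈ Ioo 0 t, HasDerivAt G (β s) s := by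
    intro s hs
    have hn : Icc 0 T ∈ nhds s := Icc_mem_nhds hs.1 (hs.2.trans_le ht.2)
    have := intervalIntegral.integral_hasDerivAt_right (hβi s (Ioo_subset_Icc_self hs))
      (hβ.mono Ioo_subset_Icc_self |>.stronglyMeasurableAtFilter isOpen_Ioo s ⟨hs.1, hs.2.trans_le ht.2⟩)
      (hβ.continuousAt hn)
    exact this.const_add _
  have hqc : ContinuousOn (fun s => β s / G s) (Icc 0 t) :=
    (hβ.mono hsub).div hGc fun s hs => (hGpos s hs).ne'
  have hlog : ∫ s in (0:ℝ)..t, β s / G s = Real.log (G t) - Real.log (G 0) := by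
    refine intervalIntegral.integral_eq_sub_of_hasDerivAt_of_le ht.1
      (hGc.log fun s hs => (hGpos s hs).ne')
      (fun s hs => (hGd s hs).log (hGpos s (Ioo_subset_Icc_self hs)).ne') ?_
    exact ContinuousOn.intervalIntegrable (by rwa [uIcc_of_le ht.1])
  have hle : ∫ s in (0:ℝ)..t, β s / G s ≤ ∫ s in (0:ℝ)..t, B s := by
    refine intervalIntegral.integral_mono_ae_restrict ht.1
      (ContinuousOn.intervalIntegrable (by rwa [uIcc_of_le ht.1])) ?_ ?_
    · rw [intervalIntegrable_iff_integrableOn_Icc_of_le ht.1]; exact hB.mono_set hsub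
    · have h1 := ae_restrict_of_ae_restrict_of_subset hsub hae
      filter_upwards [h1, ae_restrict_mem measurableSet_Icc] with s hs hs'
      rw [div_le_iff₀ (hGpos s hs')]
      exact hs.trans (mul_le_mul_of_nonneg_left (hF s (hsub hs')) (hB0 s))
  have hG0 : G 0 = F 0 := by simp [hG]
  have h0 : 0 < G 0 := hG0 ▸ hF0
  have htp := hGpos t ⟨ht.1, le_rfl⟩
  calc F t ≤ G t := hF t ht
    _ = F 0 * Real.exp (Real.log (G t) - Real.log (G 0)) := by
      rw [Real.exp_sub, Real.exp_log htp, Real.exp_log h0, hG0]; field_simp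
    _ ≤ _ := by
      gcongr; rw [← hlog]; exact hle

lemma mixed {T L : ℝ} {φ : ℝ → ℝ → ℝ}
    (hφ3 : CtC3 (Icc 0 T) L φ) (hφ1 : C1tC1 (Icc 0 T) L φ)
    {t x : ℝ} (ht : t ∈ Ioo 0 T) (hx : x ∈ Ioo 0 L) :
    HasDerivAt (pdt φ t) (pdt (pdx φ) t x) x := by
  obtain ⟨⟨hc0, hc1, hc2, hd⟩, hc3, hd3⟩ := hφ3
  obtain ⟨⟨hct, hdt⟩, hctx, hdtx⟩ := hφ1
  have hL : 0 ≤ L := (hx.1.trans hx.2).le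
  have key : ∀ y ∈ Icc 0 L, pdt φ t y = pdt φ t 0 + ∫ z in (0:ℝ)..y, pdt (pdx φ) t z := by
    intro y hy
    have h1 := derivParam (T := T) hy.1 le_rfl hy.2 hc1 hctx
      (fun s hs z hz => (hdtx s (Ioo_subset_Icc_self hs) z hz).hasDerivAt) ht
    have ht' := Ioo_subset_Icc_self ht
    have h2 := (hdt t ht' y hy).hasDerivAt.sub (hdt t ht' 0 ⟨le_rfl, hL⟩).hasDerivAt
    have h3 : (fun s => ∫ z in (0:ℝ)..y, pdx φ s z) =ᶠ[nhds t]
        ((fun τ => φ τ y) - fun τ => φ τ 0) := by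
      filter_upwards [Ioo_mem_nhds ht.1 ht.2] with s hs
      have hs' := Ioo_subset_Icc_self hs
      have hsub : uIcc 0 y ⊆ Icc 0 L := by
        rw [uIcc_of_le hy.1]; exact Icc_subset_Icc_right hy.2
      exact intervalIntegral.integral_eq_sub_of_hasDerivAt
        (fun z hz => (hd s hs' z (hsub hz)).1.hasDerivAt)
        ((slice_cont hc1 hs').mono hsub).intervalIntegrable
    have h4 := (h1.congr_of_eventuallyEq h3.symm).unique h2
    change _ = pdt φ t y - pdt φ t 0 at h4
    linarith
  have hsc := slice_cont hctx (Ioo_subset_Icc_self ht)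
  have h5 : HasDerivAt (fun y => ∫ z in (0:ℝ)..y, pdt (pdx φ) t z) (pdt (pdx φ) t x) x := by
    refine intervalIntegral.integral_hasDerivAt_right ?_
      (hsc.mono Ioo_subset_Icc_self |>.stronglyMeasurableAtFilter isOpen_Ioo x hx)
      (hsc.continuousAt (Icc_mem_nhds hx.1 hx.2))
    refine (hsc.mono ?_).intervalIntegrable
    rw [uIcc_of_le hx.1.le]; exact Icc_subset_Icc_right hx.2.le
  refine (h5.const_add (pdt φ t 0)).congr_of_eventuallyEq ?_
  filter_upwards [Icc_mem_nhds hx.1 hx.2] with y hy using key y hy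

lemma space_ineq {L T η : ℝ} (hL : 0 < L) (hη : 0 < η)
    {φ a b : ℝ → ℝ → ℝ}
    (hφ3 : CtC3 (Icc 0 T) L φ) (hφ1 : C1tC1 (Icc 0 T) L φ)
    (ha : CtC1 (Icc 0 T) L a) (hb : CtC1 (Icc 0 T) L b)
    (hpde : ∀ t ∈ Ioo 0 T, ∀ x ∈ Ioo 0 L,
      pdt φ t x = η * pdx (pdx φ) t x + a t x * pdx φ t x + b t x)
    (hbc : ∀ t ∈ Ioo 0 T, ∀ x ∈ ({0, L} : Set ℝ), pdx φ t x = 0)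
    {M : ℝ} (hM : ∀ t ∈ Icc 0 T, ∀ x ∈ Icc 0 L, |a t x| ≤ M)
    {ε : ℝ} (hε : 0 < ε) {t : ℝ} (ht : t ∈ Ioo 0 T) :
    ∫ x in (0:ℝ)..L, pdx φ t x / JJ ε (pdx φ t x) * pdt (pdx φ) t x ≤
      (∫ x in (0:ℝ)..L, |pdx b t x|) + ε * (M ^ 2 / (4 * η)) * L := by
  have ht' := Ioo_subset_Icc_self ht
  have hmix := fun x hx => mixed hφ3 hφ1 (x := x) ht hx
  obtain ⟨⟨hc0, hc1, hc2, hd⟩, hc3, hd3⟩ := hφ3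
  obtain ⟨⟨hct, hdt⟩, hctx, hdtx⟩ := hφ1
  obtain ⟨ha0, ha1, had⟩ := ha
  obtain ⟨hb0, hb1, hbd⟩ := hb
  have c1 := slice_cont hc1 ht'
  have c2 := slice_cont hc2 ht'
  have c3 := slice_cont hc3 ht'
  have ca := slice_cont ha0 ht'
  have ca1 := slice_cont ha1 ht'
  have cb1 := slice_cont hb1 ht'
  have ctx := slice_cont hctx ht'
  have cJ : ContinuousOn (fun x => JJ ε (pdx φ t x)) (Icc 0 L) := (JJ_cont ε).comp_continuousOn c1
  have cJ1 : ContinuousOn (fun x => pdx φ t x / JJ ε (pdx φ t x)) (Icc 0 L) :=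
    c1.div cJ fun x _ => (JJ_pos hε _).ne'
  have cJ2 : ContinuousOn (fun x => ε ^ 2 / JJ ε (pdx φ t x) ^ 3) (Icc 0 L) :=
    continuousOn_const.div (cJ.pow 3) fun x _ => (pow_pos (JJ_pos hε _) 3).ne'
  have hg : ∀ x ∈ Ioo 0 L, pdt (pdx φ) t x = η * pdx (pdx (pdx φ)) t x
      + (pdx a t x * pdx φ t x + a t x * pdx (pdx φ) t x) + pdx b t x := by
    intro x hx
    have hx' := Ioo_subset_Icc_self hx
    have h1 := (((hd3 t ht' x hx').hasDerivAt.const_mul η).add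
      ((had t ht' x hx').hasDerivAt.mul (hd t ht' x hx').2.hasDerivAt)).add
      (hbd t ht' x hx').hasDerivAt
    refine (hmix x hx).unique (h1.congr_of_eventuallyEq ?_)
    filter_upwards [Ioo_mem_nhds hx.1 hx.2] with y hy using hpde t ht y hy
  let h' : ℝ → ℝ := fun x => ε ^ 2 / JJ ε (pdx φ t x) ^ 3 * pdx (pdx φ) t x *
      (η * pdx (pdx φ) t x + a t x * pdx φ t x) +
      pdx φ t x / JJ ε (pdx φ t x) * (η * pdx (pdx (pdx φ)) t x
      + (pdx a t x * pdx φ t x + a t x * pdx (pdx φ) t x))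
  have ch' : ContinuousOn h' (Icc 0 L) := by
    simp only [h']; fun_prop
  have ii : ∀ {f : ℝ → ℝ}, ContinuousOn f (Icc 0 L) → IntervalIntegrable f volume 0 L :=
    fun hf => ContinuousOn.intervalIntegrable (by rwa [uIcc_of_le hL.le])
  have hzero : ∫ x in (0:ℝ)..L, h' x = 0 := by
    rw [intervalIntegral.integral_eq_sub_of_hasDerivAt
      (f := fun x => pdx φ t x / JJ ε (pdx φ t x) * (η * pdx (pdx φ) t x + a t x * pdx φ t x))
      (fun x hx => ?_) (ii ch')]
    · simp [hbc t ht 0 (by simp), hbc t ht L (by simp)]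
    · rw [uIcc_of_le hL.le] at hx
      have e1 := (hd t ht' x hx).2.hasDerivAt
      have e2 : HasDerivAt (fun x => pdx φ t x / JJ ε (pdx φ t x)) _ x :=
        (JJ_deriv2 hε (pdx φ t x)).comp x e1
      have e3 := ((hd3 t ht' x hx).hasDerivAt.const_mul η).add ((had t ht' x hx).hasDerivAt.mul e1)
      exact e2.mul e3
  have cbabs : ContinuousOn (fun x => |pdx b t x|) (Icc 0 L) := cb1.abs
  have hmono : ∫ x in (0:ℝ)..L, pdx φ t x / JJ ε (pdx φ t x) * pdt (pdx φ) t x ≤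
      ∫ x in (0:ℝ)..L, ((h' x + |pdx b t x|) + ε * (M ^ 2 / (4 * η))) := by
    refine intervalIntegral.integral_mono_on_of_le_Ioo hL.le (ii (cJ1.mul ctx))
      (ii ((ch'.add cbabs).add continuousOn_const)) fun x hx => ?_
    have hx' := Ioo_subset_Icc_self hx
    rw [hg x hx]
    have y := young (p := pdx (pdx φ) t x) hη
      (div_nonneg (sq_nonneg ε) (pow_pos (JJ_pos hε (pdx φ t x)) 3).le)
      (JJ_d2_sq hε (pdx φ t x)) (hM t ht' x hx')
    have z : pdx φ t x / JJ ε (pdx φ t x) * pdx b t x ≤ |pdx b t x| := by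
      refine (le_abs_self _).trans ?_
      rw [abs_mul]
      exact mul_le_of_le_one_left (abs_nonneg _) (JJ_d_abs hε _)
    simp only [h']
    linarith
  refine hmono.trans (le_of_eq ?_)
  have chb : ContinuousOn (fun x => h' x + |pdx b t x|) (Icc 0 L) := ch'.add cbabs
  rw [intervalIntegral.integral_add (ii chb) (by simp),
    intervalIntegral.integral_add (ii ch') (ii cbabs), hzero]
  simp; ring

lemma energy {L T η : ℝ} (hL : 0 < L) (hT : 0 < T) (hη : 0 < η)
    {φ a b : ℝ → ℝ → ℝ}
    (hφ3 : CtC3 (Icc 0 T) L φ) (hφ1 : C1tC1 (Icc 0 T) L φ)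
    (ha : CtC1 (Icc 0 T) L a) (hb : CtC1 (Icc 0 T) L b)
    (hpde : ∀ t ∈ Ioo 0 T, ∀ x ∈ Ioo 0 L,
      pdt φ t x = η * pdx (pdx φ) t x + a t x * pdx φ t x + b t x)
    (hbc : ∀ t ∈ Ioo 0 T, ∀ x ∈ ({0, L} : Set ℝ), pdx φ t x = 0)
    {t : ℝ} (ht : t ∈ Icc 0 T) :
    ∫ x in (0:ℝ)..L, |pdx φ t x| ≤ (∫ x in (0:ℝ)..L, |pdx φ 0 x|) +
      ∫ s in (0:ℝ)..t, ∫ x in (0:ℝ)..L, |pdx b s x| := by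
  obtain ⟨M, hM⟩ := (isCompact_Icc.prod isCompact_Icc).exists_bound_of_continuousOn ha.1
  have hM' : ∀ t ∈ Icc 0 T, ∀ x ∈ Icc 0 L, |a t x| ≤ M := fun t ht x hx => hM (t, x) ⟨ht, hx⟩
  have hsp := fun ε hε s hs => space_ineq hL hη hφ3 hφ1 ha hb hpde hbc hM' (ε := ε) hε (t := s) hs
  have hc1 := hφ3.1.2.1
  obtain ⟨⟨hct, hdt⟩, hctx, hdtx⟩ := hφ1
  set β : ℝ → ℝ := fun s => ∫ x in (0:ℝ)..L, |pdx b s x| with hβdef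
  have hβ : ContinuousOn β (Icc 0 T) := contParam (f := fun s x => |pdx b s x|) hT.le hL.le hb.2.1.abs
  set K := M ^ 2 / (4 * η) with hK
  have hK0 : 0 ≤ K := by positivity
  have h0 : (0:ℝ) ∈ Icc 0 T := ⟨le_rfl, hT.le⟩
  have ii : ∀ {f : ℝ → ℝ}, ContinuousOn f (Icc 0 L) → IntervalIntegrable f volume 0 L :=
    fun hf => ContinuousOn.intervalIntegrable (by rwa [uIcc_of_le hL.le])
  have main : ∀ ε > 0, ∫ x in (0:ℝ)..L, |pdx φ t x| ≤ (∫ x in (0:ℝ)..L, |pdx φ 0 x|) +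
      (∫ s in (0:ℝ)..t, β s) + ε * (L + K * L * T) := by
    intro ε hε
    have jJ : JointCont (Icc 0 T) (Icc 0 L) (fun s x => JJ ε (pdx φ s x)) :=
      (JJ_cont ε).comp_continuousOn hc1
    have jJ' : JointCont (Icc 0 T) (Icc 0 L)
        (fun s x => pdx φ s x / JJ ε (pdx φ s x) * pdt (pdx φ) s x) :=
      (ContinuousOn.div hc1 jJ fun x _ => (JJ_pos hε _).ne').mul hctx
    have hder : ∀ s ∈ Ioo 0 T, HasDerivAt (fun s => ∫ x in (0:ℝ)..L, JJ ε (pdx φ s x))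
        (∫ x in (0:ℝ)..L, pdx φ s x / JJ ε (pdx φ s x) * pdt (pdx φ) s x) s := fun s hs =>
      derivParam hL.le le_rfl le_rfl jJ jJ' (fun s hs x hx =>
        HasDerivAt.comp (h₂ := JJ ε) (h := fun τ => pdx φ τ x) s (JJ_deriv hε (pdx φ s x)) (hdtx s (Ioo_subset_Icc_self hs) x hx).hasDerivAt) hs
    have hcont := contParam hT.le hL.le jJ
    have hprim : ContinuousOn (fun s => ∫ u in (0:ℝ)..s, β u) (Icc 0 T) := by
      have := intervalIntegral.continuousOn_primitive_interval
        (f := β) (μ := volume) (a := 0) (b := T)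
        (by rw [uIcc_of_le hT.le]; exact hβ.integrableOn_Icc)
      rwa [uIcc_of_le hT.le] at this
    have hprimd : ∀ s ∈ Ioo 0 T, HasDerivAt (fun s => ∫ u in (0:ℝ)..s, β u) (β s) s := by
      intro s hs
      refine intervalIntegral.integral_hasDerivAt_right ?_
        (hβ.mono Ioo_subset_Icc_self |>.stronglyMeasurableAtFilter isOpen_Ioo s hs)
        (hβ.continuousAt (Icc_mem_nhds hs.1 hs.2))
      refine (hβ.mono ?_).intervalIntegrable
      rw [uIcc_of_le hs.1.le]; exact Icc_subset_Icc_right hs.2.le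
    have hDd : ∀ s ∈ Ioo 0 T, HasDerivAt (fun s => (∫ x in (0:ℝ)..L, JJ ε (pdx φ s x)) -
        (∫ u in (0:ℝ)..s, β u) - ε * K * L * s)
        ((∫ x in (0:ℝ)..L, pdx φ s x / JJ ε (pdx φ s x) * pdt (pdx φ) s x) - β s
          - ε * K * L * 1) s := fun s hs =>
      ((hder s hs).sub (hprimd s hs)).sub ((hasDerivAt_id s).const_mul _)
    have hanti : AntitoneOn (fun s => (∫ x in (0:ℝ)..L, JJ ε (pdx φ s x)) -
        (∫ u in (0:ℝ)..s, β u) - ε * K * L * s) (Icc 0 T) := by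
      refine antitoneOn_of_deriv_nonpos (convex_Icc 0 T)
        ((hcont.sub hprim).sub (by fun_prop)) ?_ ?_
      · rw [interior_Icc]
        exact fun s hs => (hDd s hs).differentiableAt.differentiableWithinAt
      · rw [interior_Icc]
        intro s hs
        rw [(hDd s hs).deriv]
        have := hsp ε hε s hs
        simp only [hβdef]
        linarith
    have hfin := hanti h0 ht ht.1
    simp only [intervalIntegral.integral_same] at hfin
    have l1 : ∫ x in (0:ℝ)..L, |pdx φ t x| ≤ ∫ x in (0:ℝ)..L, JJ ε (pdx φ t x) :=
      intervalIntegral.integral_mono_on hL.le (ii (slice_cont hc1 ht).abs) (ii (slice_cont jJ ht))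
        fun x _ => JJ_abs_le _
    have l2 : ∫ x in (0:ℝ)..L, JJ ε (pdx φ 0 x) ≤ ∫ x in (0:ℝ)..L, (|pdx φ 0 x| + ε) :=
      intervalIntegral.integral_mono_on hL.le (ii (slice_cont jJ h0))
        (ii ((slice_cont hc1 h0).abs.add continuousOn_const)) fun x _ => JJ_le hε _
    rw [intervalIntegral.integral_add (ii (slice_cont hc1 h0).abs) (by simp)] at l2
    simp only [intervalIntegral.integral_const, smul_eq_mul, sub_zero] at l2
    have l3 : ε * K * L * t ≤ ε * K * L * T :=
      mul_le_mul_of_nonneg_left ht.2 (by positivity)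
    linarith
  have hC : 0 < L + K * L * T := by positivity
  refine le_of_forall_pos_le_add fun δ hδ => ?_
  have := main (δ / (L + K * L * T)) (by positivity)
  rwa [div_mul_cancel₀ _ hC.ne'] at this

/-- the abstract Grönwall argument on the first-order energy
`t ↦ ∫_Ω |∂_x φ(t)| dx`, and the resulting `BV` estimate for a comparable ratio. -/
theorem gronwall_BV_estimate (L T η : ℝ) (hL : 0 < L) (hT : 0 < T) (hη : 0 < η)
    (φ a b : ℝ → ℝ → ℝ)
    (hφ3 : CtC3 (Icc 0 T) L φ) (hφ1 : C1tC1 (Icc 0 T) L φ)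
    (ha : CtC1 (Icc 0 T) L a) (hb : CtC1 (Icc 0 T) L b)
    (hpde : ∀ t ∈ Ioo 0 T, ∀ x ∈ Ioo 0 L,
      pdt φ t x = η * pdx (pdx φ) t x + a t x * pdx φ t x + b t x)
    (hbc : ∀ t ∈ Ioo 0 T, ∀ x ∈ ({0, L} : Set ℝ), pdx φ t x = 0)
    (B : ℝ → ℝ) (hBint : IntegrableOn B (Icc 0 T)) (hBpos : ∀ t, 0 ≤ B t)
    (hBineq : ∀ᵐ t ∂(volume.restrict (Icc 0 T)),
      (∫ x in Ioo 0 L, |pdx b t x|) ≤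
        B t * (1 + ∫ x in Ioo 0 L, |pdx φ t x|)) :
    (∀ t ∈ Icc 0 T,
      (∫ x in Ioo 0 L, |pdx φ t x|) + 1 ≤
        ((∫ x in Ioo 0 L, |pdx φ 0 x|) + 1) * Real.exp (∫ s in (0:ℝ)..t, B s)) ∧
    ∀ r : ℝ → ℝ → ℝ,
      (∀ t ∈ Icc 0 T, ContDiffOn ℝ 1 (r t) (Icc 0 L)) →
      ∀ Λ1 Λ2 : ℝ, 0 < Λ1 → 0 < Λ2 →
        (∀ t ∈ Icc 0 T,
          (∫ x in Ioo 0 L, |pdx φ t x|) ≤ Λ1 * ((∫ x in Ioo 0 L, |pdx r t x|) + 1)) →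
        (∀ t ∈ Icc 0 T,
          (∫ x in Ioo 0 L, |pdx r t x|) ≤ Λ2 * ((∫ x in Ioo 0 L, |pdx φ t x|) + 1)) →
        ∀ t ∈ Icc 0 T,
          (∫ x in Ioo 0 L, |pdx r t x|) ≤
            Λ2 * (1 + Λ1 * (1 + ∫ x in Ioo 0 L, |pdx r 0 x|)) *
              Real.exp (∫ s in (0:ℝ)..T, B s) := by
  have hIoo : ∀ f : ℝ → ℝ, ∫ x in Ioo 0 L, f x = ∫ x in (0:ℝ)..L, f x := fun f => by
    rw [intervalIntegral.integral_of_le hL.le, integral_Ioc_eq_integral_Ioo]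
  have habs : ∀ f : ℝ → ℝ, 0 ≤ ∫ x in Ioo 0 L, |f x| := fun f =>
    integral_nonneg fun x => abs_nonneg _
  have hfirst : ∀ t ∈ Icc 0 T,
      (∫ x in Ioo 0 L, |pdx φ t x|) + 1 ≤
        ((∫ x in Ioo 0 L, |pdx φ 0 x|) + 1) * Real.exp (∫ s in (0:ℝ)..t, B s) := by
    refine gron (F := fun t => (∫ x in Ioo 0 L, |pdx φ t x|) + 1)
      (β := fun t => ∫ x in Ioo 0 L, |pdx b t x|) ?_ ?_ ?_ ?_ hBint hBpos ?_
    · simp only [hIoo]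
      exact contParam (f := fun s x => |pdx b s x|) hT.le hL.le hb.2.1.abs
    · have := habs (pdx φ 0)
      linarith
    · exact fun t _ => habs _
    · intro t ht
      have := energy hL hT hη hφ3 hφ1 ha hb hpde hbc ht
      simp only [hIoo]
      linarith
    · filter_upwards [hBineq] with t h
      rwa [add_comm] at h
  refine ⟨hfirst, fun r _ Λ1 Λ2 h1 h2 hA hR t ht => ?_⟩
  have h0 : (0:ℝ) ∈ Icc 0 T := ⟨le_rfl, hT.le⟩
  have hexp : Real.exp (∫ s in (0:ℝ)..t, B s) ≤ Real.exp (∫ s in (0:ℝ)..T, B s) := by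
    refine Real.exp_le_exp.2 (intervalIntegral.integral_mono_interval le_rfl ht.1 ht.2 ?_ ?_)
    · exact Filter.Eventually.of_forall fun s => hBpos s
    · rwa [intervalIntegrable_iff_integrableOn_Icc_of_le hT.le]
  have hp := habs (pdx r 0)
  calc _ ≤ _ := hR t ht
    _ ≤ Λ2 * (((∫ x in Ioo 0 L, |pdx φ 0 x|) + 1) * Real.exp (∫ s in (0:ℝ)..t, B s)) := by
      gcongr; exact hfirst t ht
    _ ≤ Λ2 * ((1 + Λ1 * (1 + ∫ x in Ioo 0 L, |pdx r 0 x|)) *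
          Real.exp (∫ s in (0:ℝ)..T, B s)) := by
      have := hA 0 h0
      refine mul_le_mul_of_nonneg_left (mul_le_mul ?_ hexp (Real.exp_pos _).le ?_) h2.le
      · linarith
      · positivity
    _ = _ := by ring
end

section
/- Let Ω = (0,L) and T > 0, and let g : [0,T]×[0,L] → ℝ be such that g and ∂_t g are continuous on [0,T]×[0,L] (i.e. g ∈ C¹([0,T]; C([0,L]))). Then the function G(t) := ∫_Ω |g(t,x)| dx is Lipschitz continuous on [0,T], hence differentiable at almost every t ∈ [0,T], and for almost every t ∈ [0,T]: G'(t) = ∫_Ω sgn(g(t,x)) ∂_t g(t,x) dx, where sgn denotes the sign function (with sgn(0) = 0). -/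
open MeasureTheory Set

lemma aux_countable (f : ℝ → ℝ) (s : Set ℝ)
    (hs : ∀ t ∈ s, f t = 0 ∧ DifferentiableAt ℝ f t ∧ deriv f t ≠ 0) : s.Countable := by
  have : DiscreteTopology s := by
    rw [discreteTopology_subtype_iff]
    intro t ht
    obtain ⟨h0, hd, hne⟩ := hs t ht
    have h1 : ∀ᶠ z in nhdsWithin t {t}ᶜ, f z ≠ 0 := hd.hasDerivAt.eventually_ne hne
    rw [← Filter.empty_mem_iff_bot, Filter.mem_inf_principal]
    filter_upwards [h1] with z hz hzs
    exact hz (hs z hzs).1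
  have : Countable s := countable_of_Lindelof_of_discrete
  exact Set.to_countable s

lemma aux_deriv (f : ℝ → ℝ) (t : ℝ) (hd : DifferentiableAt ℝ f t)
    (h : f t = 0 → deriv f t = 0) :
    HasDerivAt (fun τ => |f τ|) (Real.sign (f t) * deriv f t) t := by
  rcases lt_trichotomy (f t) 0 with h0 | h0 | h0
  · rw [Real.sign_of_neg h0]
    exact (hasDerivAt_abs_neg h0).comp t hd.hasDerivAt
  · have h1 := hd.hasDerivAt
    rw [h h0] at h1 ⊢
    rw [hasDerivAt_iff_isLittleO] at h1 ⊢
    simp only [h0, smul_zero, sub_zero, abs_zero, mul_zero] at h1 ⊢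
    exact h1.abs_left
  · rw [Real.sign_of_pos h0]
    exact (hasDerivAt_abs_pos h0).comp t hd.hasDerivAt

lemma aux_sign : Measurable Real.sign := by
  unfold Real.sign
  exact Measurable.ite measurableSet_Iio measurable_const
    (Measurable.ite measurableSet_Ioi measurable_const measurable_const)

/-- for `g ∈ C¹([0,T]; C([0,L]))`, the map `G(t) = ∫_Ω |g(t,x)| dx` is
Lipschitz on `[0,T]` and for a.e. `t` it is differentiable with
`G'(t) = ∫_Ω sgn(g(t,x)) ∂_t g(t,x) dx`. -/
theorem abs_energy_differentiable (L T : ℝ) (hL : 0 < L) (hT : 0 < T)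
    (g : ℝ → ℝ → ℝ)
    (hg : ContinuousOn (fun p : ℝ × ℝ => g p.1 p.2) (Icc 0 T ×ˢ Icc 0 L))
    (hgt : ContinuousOn (fun p : ℝ × ℝ => pdt g p.1 p.2) (Icc 0 T ×ˢ Icc 0 L))
    (hdiff : ∀ t ∈ Icc 0 T, ∀ x ∈ Icc 0 L, DifferentiableAt ℝ (fun τ => g τ x) t) :
    (∃ K : NNReal, LipschitzOnWith K (fun t => ∫ x in Ioo 0 L, |g t x|) (Icc 0 T)) ∧
    ∀ᵐ t ∂(volume.restrict (Icc 0 T)),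
      HasDerivAt (fun τ => ∫ x in Ioo 0 L, |g τ x|)
        (∫ x in Ioo 0 L, Real.sign (g t x) * pdt g t x) t := by
  obtain ⟨C, hC⟩ := (isCompact_Icc.prod isCompact_Icc).exists_bound_of_continuousOn hgt
  have hC0 : 0 ≤ C := (norm_nonneg _).trans
    (hC (0, 0) ⟨⟨le_rfl, hT.le⟩, ⟨le_rfl, hL.le⟩⟩)
  have hlip : ∀ x ∈ Icc 0 L, ∀ s ∈ Icc 0 T, ∀ t ∈ Icc 0 T,
      |(|g s x| - |g t x|)| ≤ C * |s - t| := by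
    intro x hx s hs t ht
    refine (abs_abs_sub_abs_le_abs_sub _ _).trans ?_
    exact (convex_Icc 0 T).norm_image_sub_le_of_norm_deriv_le (f := fun τ => g τ x)
      (fun τ hτ => hdiff τ hτ x hx) (fun τ hτ => hC (τ, x) ⟨hτ, hx⟩) ht hs
  have hcx : ∀ t ∈ Icc 0 T, ContinuousOn (fun x => g t x) (Icc 0 L) := fun t ht =>
    hg.comp (f := fun x => (t, x)) (by fun_prop) (fun x hx => ⟨ht, hx⟩)
  have hcx' : ∀ t ∈ Icc 0 T, ContinuousOn (fun x => pdt g t x) (Icc 0 L) := fun t ht =>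
    hgt.comp (f := fun x => (t, x)) (by fun_prop) (fun x hx => ⟨ht, hx⟩)
  have hint : ∀ t ∈ Icc 0 T, IntegrableOn (fun x => |g t x|) (Ioo 0 L) := fun t ht =>
    ((hcx t ht).abs.integrableOn_Icc).mono_set Ioo_subset_Icc_self
  constructor
  · refine ⟨⟨C * L, by positivity⟩, LipschitzOnWith.of_dist_le_mul ?_⟩
    intro s hs t ht
    rw [Real.dist_eq, Real.dist_eq, ← integral_sub (hint s hs) (hint t ht)]
    have := norm_setIntegral_le_of_norm_le_const (μ := volume) (s := Ioo 0 L)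
      (f := fun x => |g s x| - |g t x|) (C := C * |s - t|) (by simp)
      (fun x hx => hlip x (Ioo_subset_Icc_self hx) s hs t ht)
    rw [Real.norm_eq_abs] at this
    refine this.trans_eq ?_
    rw [Real.volume_real_Ioo_of_le hL.le, sub_zero]
    change C * |s - t| * L = C * L * |s - t|
    ring
  · have hclosed : IsClosed (Icc (0:ℝ) T ×ˢ Icc (0:ℝ) L) := isClosed_Icc.prod isClosed_Icc
    have hm1 := (hg.preimage_isClosed_of_isClosed hclosed (isClosed_singleton (x := (0:ℝ)))).measurableSet
    have hm2 := (hgt.preimage_isClosed_of_isClosed hclosed (isClosed_singleton (x := (0:ℝ)))).measurableSet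
    have hm := (hm1.diff hm2).compl
    set E := (Icc (0:ℝ) T ×ˢ Icc (0:ℝ) L ∩ (fun p : ℝ × ℝ => g p.1 p.2) ⁻¹' {0}) \
      (Icc (0:ℝ) T ×ˢ Icc (0:ℝ) L ∩ (fun p : ℝ × ℝ => pdt g p.1 p.2) ⁻¹' {0}) with hE
    have hae : ∀ᵐ t : ℝ, ∀ᵐ x : ℝ, (t, x) ∈ Eᶜ := by
      rw [Measure.ae_ae_comm (p := fun t x => (t, x) ∈ Eᶜ) hm]
      refine Filter.Eventually.of_forall fun x => ?_
      rw [ae_iff]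
      refine (aux_countable (fun τ => g τ x) _ ?_).measure_zero _
      intro t ht
      simp only [mem_compl_iff, not_not, mem_setOf_eq] at ht
      obtain ⟨⟨hp, h0⟩, h1⟩ := ht
      exact ⟨h0, hdiff t hp.1 x hp.2, fun h => h1 ⟨hp, h⟩⟩
    rw [← restrict_Ioo_eq_restrict_Icc, ae_restrict_iff' measurableSet_Ioo]
    filter_upwards [hae] with t ht htI
    have htc := Ioo_subset_Icc_self htI
    have hnhds : Ioo 0 T ∈ nhds t := Ioo_mem_nhds htI.1 htI.2
    refine (hasDerivAt_integral_of_dominated_loc_of_lip (μ := volume.restrict (Ioo 0 L))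
      (F := fun τ x => |g τ x|) (bound := fun _ => C)
      (F' := fun x => Real.sign (g t x) * pdt g t x) hnhds ?_ (hint t htc) ?_ ?_ ?_ ?_).2
    · filter_upwards [hnhds] with τ hτ
      exact (hint τ (Ioo_subset_Icc_self hτ)).aestronglyMeasurable
    · have a1 : AEMeasurable (fun x => g t x) (volume.restrict (Ioo 0 L)) :=
        ((hcx t htc).mono Ioo_subset_Icc_self).aemeasurable measurableSet_Ioo
      have a2 : AEMeasurable (fun x => pdt g t x) (volume.restrict (Ioo 0 L)) :=
        ((hcx' t htc).mono Ioo_subset_Icc_self).aemeasurable measurableSet_Ioo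
      exact ((aux_sign.comp_aemeasurable a1).mul a2).aestronglyMeasurable
    · refine (ae_restrict_mem measurableSet_Ioo).mono fun x hx => ?_
      refine LipschitzOnWith.of_dist_le_mul fun s hs r hr => ?_
      rw [Real.dist_eq, Real.dist_eq, Real.coe_nnabs, abs_of_nonneg hC0]
      exact hlip x (Ioo_subset_Icc_self hx) s (Ioo_subset_Icc_self hs) r (Ioo_subset_Icc_self hr)
    · exact integrable_const _
    · rw [ae_restrict_iff' measurableSet_Ioo]
      filter_upwards [ht] with x hxE hx
      have hxc := Ioo_subset_Icc_self hx
      refine aux_deriv (fun τ => g τ x) t (hdiff t htc x hxc) fun h0 => ?_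
      by_contra hne
      exact hxE ⟨⟨⟨htc, hxc⟩, h0⟩, fun h => hne h.2⟩
end
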